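/- arXiv:1308.1177 — 2 statements merged into one kernel-verified Lean document; each statement's English description precedes it below -/
import Mathlib

section
/- Let E⁰, B⁰ : Ω̄ → ℝ³ be continuous toroidally symmetric vector fields and define the transport operator D g = v̂·∇ₓ g + (E⁰(x) + v̂×B⁰(x))·∇_v g. Let g ∈ C¹(Ω̄ × ℝ³) be toroidally symmetric. Then g is specular on ∂Ω if and only if for every toroidally symmetric h ∈ C¹(Ω̄ × ℝ³) that has compact support in v and is specular on ∂Ω one has ∫_Ω ∫_{ℝ³} g (D h) dv dx = − ∫_Ω ∫_{ℝ³} (D g) h dv dx. -/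
open MeasureTheory Real Set Filter
open scoped ENNReal NNReal

noncomputable section

abbrev R3 : Type := Fin 3 → ℝ

/-- The open solid torus with major radius `a` and minor radius `1`. -/
def torus (a : ℝ) : Set R3 :=
  {x | (a - Real.sqrt ((x 0) ^ 2 + (x 1) ^ 2)) ^ 2 + (x 2) ^ 2 < 1}

/-- Distance to the `x₃`-axis, `ρ(x) = √(x₁² + x₂²)`. -/
def rad (x : R3) : ℝ := Real.sqrt ((x 0) ^ 2 + (x 1) ^ 2)

/-- The toroidal unit vector `e_φ(x) = (-x₂, x₁, 0)/ρ(x)`. -/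
def ephi (x : R3) : R3 := ![-(x 1) / rad x, x 0 / rad x, 0]

/-- Euclidean dot product on `ℝ³`. -/
def dot (u v : R3) : ℝ := ∑ i, u i * v i

/-- Cross product on `ℝ³`. -/
def cross (u v : R3) : R3 :=
  ![u 1 * v 2 - u 2 * v 1, u 2 * v 0 - u 0 * v 2, u 0 * v 1 - u 1 * v 0]

/-- Squared Euclidean norm. -/
def nsq (v : R3) : ℝ := ∑ i, (v i) ^ 2

/-- The relativistic energy `⟨v⟩ = √(1 + |v|²)`. -/
def vb (v : R3) : ℝ := Real.sqrt (1 + nsq v)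

/-- The relativistic velocity `v̂ = v/⟨v⟩`. -/
def vhat (v : R3) : R3 := fun i => v i / vb v

/-- `i`-th partial derivative. -/
def pd (f : R3 → ℝ) (i : Fin 3) (x : R3) : ℝ := fderiv ℝ f x (Pi.single i 1)

/-- Gradient. -/
def grad (f : R3 → ℝ) (x : R3) : R3 := fun i => pd f i x

/-- Curl of a vector field on `ℝ³`. -/
def curl (F : R3 → R3) (x : R3) : R3 :=
  ![pd (fun y => F y 2) 1 x - pd (fun y => F y 1) 2 x,
    pd (fun y => F y 0) 2 x - pd (fun y => F y 2) 0 x,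
    pd (fun y => F y 1) 0 x - pd (fun y => F y 0) 1 x]

/-- Laplacian. -/
def lap (f : R3 → ℝ) (x : R3) : ℝ := ∑ i, pd (pd f i) i x

/-- Rotation by angle `β` about the `x₃`-axis. -/
def rotZ (β : ℝ) (x : R3) : R3 :=
  ![Real.cos β * x 0 - Real.sin β * x 1, Real.sin β * x 0 + Real.cos β * x 1, x 2]

/-- Toroidal symmetry of a scalar function of `x`. -/
def torSym (f : R3 → ℝ) : Prop := ∀ β x, f (rotZ β x) = f x

/-- Toroidal symmetry (equivariance) of a vector field. -/
def torSymV (F : R3 → R3) : Prop := ∀ β x, F (rotZ β x) = rotZ β (F x)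

/-- Toroidal symmetry of a function of `(x, v)`. -/
def torSym2 (g : R3 → R3 → ℝ) : Prop := ∀ β x v, g (rotZ β x) (rotZ β v) = g x v

/-- Outward unit normal at a point of `∂Ω`. -/
def nvec (a : ℝ) (x : R3) : R3 :=
  ![(rad x - a) * x 0 / rad x, (rad x - a) * x 1 / rad x, x 2]

/-- Specular reflection of the velocity `v` at the boundary point `x`. -/
def specRefl (a : ℝ) (x v : R3) : R3 := fun i => v i - 2 * dot v (nvec a x) * nvec a x i

/-- `g(x, v)` is specular on `∂Ω`. -/
def specular (a : ℝ) (g : R3 → R3 → ℝ) : Prop :=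
  ∀ x ∈ frontier (torus a), ∀ v : R3, g x v = g x (specRefl a x v)

/-- The transport (Vlasov) operator `D g = v̂·∇ₓ g + σ (E⁰ + v̂×B⁰)·∇_v g`,
with sign `σ = ±1` according to the species. -/
def DopS (σ : ℝ) (E0 B0 : R3 → R3) (g : R3 → R3 → ℝ) (x v : R3) : ℝ :=
  dot (vhat v) (grad (fun y => g y v) x)
    + σ * dot (fun i => E0 x i + cross (vhat v) (B0 x) i) (grad (fun w => g x w) v)

/-- Sign of a species: `+1` for ions (`true`), `-1` for electrons (`false`). -/
def sg (b : Bool) : ℝ := if b then 1 else -1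

/-- Partial derivative `∂_e` of a function `μ(e, p)`. -/
def d1 (F : ℝ × ℝ → ℝ) (q : ℝ × ℝ) : ℝ := fderiv ℝ F q (1, 0)

/-- Partial derivative `∂_p` of a function `μ(e, p)`. -/
def d2 (F : ℝ × ℝ → ℝ) (q : ℝ × ℝ) : ℝ := fderiv ℝ F q (0, 1)

/-- The equilibrium electric field `E⁰ = -∇φ⁰`. -/
def Efield (φ0 : R3 → ℝ) (x : R3) : R3 := fun i => -(grad φ0 x i)

/-- The equilibrium magnetic field `B⁰ = ∇×(A_φ⁰ e_φ)`. -/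
def Bfield (A : R3 → ℝ) (x : R3) : R3 := curl (fun y => fun i => A y * ephi y i) x

/-- The particle energy `e±(x,v) = ⟨v⟩ ± φ⁰(x)`. -/
def epm (σ : ℝ) (φ0 : R3 → ℝ) (x v : R3) : ℝ := vb v + σ * φ0 x

/-- The particle angular momentum `p±(x,v) = ρ(x)(v_φ ± A_φ⁰(x))`. -/
def ppm (σ : ℝ) (A : R3 → ℝ) (x v : R3) : ℝ := rad x * (dot v (ephi x) + σ * A x)



open scoped Topology

/-- Toroidal coordinates. -/
def tX (a : ℝ) (p : R3) : R3 :=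
  ![(a + p 0 * Real.cos (p 1)) * Real.cos (p 2),
    (a + p 0 * Real.cos (p 1)) * Real.sin (p 2), p 0 * Real.sin (p 1)]

lemma tX_contDiff (a : ℝ) : ContDiff ℝ 1 (tX a) := by
  unfold tX
  rw [contDiff_pi]
  intro i
  fin_cases i <;> simp <;> fun_prop

lemma tX_cont (a : ℝ) : Continuous (tX a) := (tX_contDiff a).continuous

lemma rad_tX (a : ℝ) (ha : 1 < a) (p : R3) (h0 : 0 ≤ p 0) (h1 : p 0 ≤ 1) :
    rad (tX a p) = a + p 0 * Real.cos (p 1) ∧ 0 < a + p 0 * Real.cos (p 1) := by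
  have hp : 0 < a + p 0 * Real.cos (p 1) := by
    nlinarith [Real.neg_one_le_cos (p 1)]
  refine ⟨?_, hp⟩
  unfold rad
  rw [Real.sqrt_eq_iff_mul_self_eq (by positivity) hp.le]
  simp [tX]
  linear_combination ((a + p 0 * Real.cos (p 1)) ^ 2) * (Real.sin_sq_add_cos_sq (p 2))

lemma psi_tX (a : ℝ) (ha : 1 < a) (p : R3) (h0 : 0 ≤ p 0) (h1 : p 0 ≤ 1) :
    (a - rad (tX a p)) ^ 2 + (tX a p 2) ^ 2 = p 0 ^ 2 := by
  rw [(rad_tX a ha p h0 h1).1]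
  simp [tX]
  linear_combination (p 0 ^ 2) * (Real.sin_sq_add_cos_sq (p 1))

lemma rad_cont : Continuous rad := by unfold rad; fun_prop

lemma torus_eq (a : ℝ) : torus a = {x | (a - rad x) ^ 2 + (x 2) ^ 2 < 1} := rfl

lemma torus_open (a : ℝ) : IsOpen (torus a) := by
  rw [torus_eq]
  have := rad_cont
  exact isOpen_lt (by fun_prop) (by fun_prop)

lemma torus_closure_sub (a : ℝ) : closure (torus a) ⊆ {x | (a - rad x) ^ 2 + (x 2) ^ 2 ≤ 1} := by
  rw [torus_eq]
  have := rad_cont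
  exact closure_lt_subset_le (by fun_prop) (by fun_prop)

lemma torus_frontier_sub (a : ℝ) :
    frontier (torus a) ⊆ {x | (a - rad x) ^ 2 + (x 2) ^ 2 = 1} := by
  rw [torus_eq]
  have := rad_cont
  exact frontier_lt_subset_eq (by fun_prop) (by fun_prop)

lemma rad_pos_of_closure (a : ℝ) (ha : 1 < a) {x : R3} (hx : x ∈ closure (torus a)) :
    0 < rad x := by
  have h := torus_closure_sub a hx
  simp only [mem_ofPred_eq] at h
  nlinarith [sq_nonneg (x 2)]

lemma torus_bounded (a : ℝ) (ha : 1 < a) : closure (torus a) ⊆ Metric.closedBall 0 (a + 1) := by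
  intro x hx
  have h := torus_closure_sub a hx
  simp only [mem_ofPred_eq] at h
  have h3 : rad x ≤ a + 1 := by nlinarith [sq_nonneg (x 2)]
  have h4 : rad x ^ 2 = x 0 ^ 2 + x 1 ^ 2 := Real.sq_sqrt (by positivity)
  have h5 : 0 ≤ rad x := Real.sqrt_nonneg _
  rw [mem_closedBall_zero_iff, pi_norm_le_iff_of_nonneg (by linarith)]
  intro i
  rw [Real.norm_eq_abs]
  apply abs_le_of_sq_le_sq _ (by linarith)
  fin_cases i
  · simp; nlinarith [sq_nonneg (x 1)]
  · simp; nlinarith [sq_nonneg (x 0)]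
  · simp; nlinarith [sq_nonneg (a - rad x)]

lemma torus_compact (a : ℝ) (ha : 1 < a) : IsCompact (closure (torus a)) :=
  (isCompact_closedBall _ _).of_isClosed_subset isClosed_closure (torus_bounded a ha)

lemma tX_mem_torus (a : ℝ) (ha : 1 < a) (p : R3) (h0 : 0 ≤ p 0) (h1 : p 0 < 1) :
    tX a p ∈ torus a := by
  rw [torus_eq, mem_ofPred_eq, psi_tX a ha p h0 h1.le]
  nlinarith

lemma tX_mem_closure (a : ℝ) (ha : 1 < a) (p : R3) (h0 : 0 ≤ p 0) (h1 : p 0 ≤ 1) :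
    tX a p ∈ closure (torus a) := by
  have hc : Continuous (fun t : ℝ => tX a ![t, p 1, p 2]) := by
    apply (tX_cont a).comp
    rw [continuous_pi_iff]; intro i; fin_cases i <;> simp <;> fun_prop
  have hm : MapsTo (fun t : ℝ => tX a ![t, p 1, p 2]) (Ico 0 1) (torus a) := by
    intro t ht
    exact tX_mem_torus a ha _ (by simpa using ht.1) (by simpa using ht.2)
  have := hm.closure hc
  rw [closure_Ico (by norm_num)] at this
  have h := this (show p 0 ∈ Icc (0:ℝ) 1 from ⟨h0, h1⟩)
  have e : ![p 0, p 1, p 2] = p := by ext i; fin_cases i <;> rfl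
  simpa [e] using h

/-- boundary parametrization -/
def bX (a : ℝ) (y : Fin 2 → ℝ) : R3 := tX a ![1, y 0, y 1]

lemma bX_cont (a : ℝ) : Continuous (bX a) := by
  apply (tX_cont a).comp
  rw [continuous_pi_iff]; intro i; fin_cases i <;> simp <;> fun_prop

/-- normal at the boundary point -/
def bn (y : Fin 2 → ℝ) : R3 :=
  ![Real.cos (y 0) * Real.cos (y 1), Real.cos (y 0) * Real.sin (y 1), Real.sin (y 0)]

lemma bn_cont : Continuous bn := by
  unfold bn
  rw [continuous_pi_iff]; intro i; fin_cases i <;> simp <;> fun_prop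

lemma bn_unit (y : Fin 2 → ℝ) : dot (bn y) (bn y) = 1 := by
  simp [dot, bn, Fin.sum_univ_three]
  linear_combination (Real.cos (y 0)) ^ 2 * (Real.sin_sq_add_cos_sq (y 1)) +
    (Real.sin_sq_add_cos_sq (y 0))

lemma nvec_bX (a : ℝ) (ha : 1 < a) (y : Fin 2 → ℝ) : nvec a (bX a y) = bn y := by
  obtain ⟨h1, h2⟩ := rad_tX a ha ![1, y 0, y 1] (by simp) (by simp)
  simp at h1 h2
  unfold nvec bX
  rw [h1]
  ext i
  fin_cases i <;> simp [bn, tX] <;> field_simp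

lemma bX_mem_closure (a : ℝ) (ha : 1 < a) (y : Fin 2 → ℝ) : bX a y ∈ closure (torus a) :=
  tX_mem_closure a ha _ (by simp) (by simp)

lemma bX_mem_frontier (a : ℝ) (ha : 1 < a) (y : Fin 2 → ℝ) : bX a y ∈ frontier (torus a) := by
  rw [(torus_open a).frontier_eq]
  refine ⟨bX_mem_closure a ha y, ?_⟩
  rw [torus_eq, mem_ofPred_eq]
  have := psi_tX a ha ![1, y 0, y 1] (by simp) (by simp)
  unfold bX
  rw [this]; simp

lemma polar_exists (s z : ℝ) : ∃ t ∈ Icc (-π) π, s = √(s ^ 2 + z ^ 2) * Real.cos t ∧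
    z = √(s ^ 2 + z ^ 2) * Real.sin t ∧ (z ≠ 0 → t ∈ Ioo (-π) π) := by
  refine ⟨Complex.arg ⟨s, z⟩, ⟨(Complex.neg_pi_lt_arg _).le, Complex.arg_le_pi _⟩, ?_, ?_, ?_⟩
  · have := Complex.norm_mul_cos_arg ⟨s, z⟩
    rw [Complex.norm_eq_sqrt_sq_add_sq] at this
    exact this.symm
  · have := Complex.norm_mul_sin_arg ⟨s, z⟩
    rw [Complex.norm_eq_sqrt_sq_add_sq] at this
    exact this.symm
  · intro hz
    refine ⟨Complex.neg_pi_lt_arg _, lt_of_le_of_ne (Complex.arg_le_pi _) ?_⟩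
    rw [Ne, Complex.arg_eq_pi_iff]
    exact fun h => hz h.2

lemma tX_surj (a : ℝ) (x : R3) : ∃ p : R3, tX a p = x ∧
    p 0 = √((rad x - a) ^ 2 + x 2 ^ 2) ∧ p 1 ∈ Icc (-π) π ∧ p 2 ∈ Icc (-π) π ∧
    (x 2 ≠ 0 → p 1 ∈ Ioo (-π) π) ∧ (x 1 ≠ 0 → p 2 ∈ Ioo (-π) π) := by
  obtain ⟨t, ht, h1, h2, h3⟩ := polar_exists (rad x - a) (x 2)
  obtain ⟨u, hu, k1, k2, k3⟩ := polar_exists (x 0) (x 1)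
  refine ⟨![√((rad x - a) ^ 2 + x 2 ^ 2), t, u], ?_, rfl, ht, hu, h3, k3⟩
  have e : a + √((rad x - a) ^ 2 + x 2 ^ 2) * Real.cos t = rad x := by rw [← h1]; ring
  ext i
  fin_cases i
  · simp [tX, e]; exact k1.symm
  · simp [tX, e]; exact k2.symm
  · simp [tX]; exact h2.symm

lemma bX_surj (a : ℝ) {x : R3} (hx : x ∈ frontier (torus a)) :
    ∃ y ∈ Icc (fun _ => -π : Fin 2 → ℝ) (fun _ => π), bX a y = x := by
  obtain ⟨p, h, h0, h1, h2, -⟩ := tX_surj a x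
  have := torus_frontier_sub a hx
  simp only [mem_ofPred_eq] at this
  refine ⟨![p 1, p 2], ⟨?_, ?_⟩, ?_⟩
  · intro i; fin_cases i <;> simp [h1.1, h2.1]
  · intro i; fin_cases i <;> simp [h1.2, h2.2]
  · have h0' : p 0 = 1 := by
      rw [h0, show (rad x - a) ^ 2 + x 2 ^ 2 = 1 by linarith [this, sq_nonneg (rad x - a)]]
      simp
    rw [← h, bX]
    congr 1
    ext i; fin_cases i <;> simp [h0']

/-- the open coordinate box -/
def obox : Set R3 := Set.pi univ fun i =>
  Ioo ((![0, -π, -π] : R3) i) ((![1, π, π] : R3) i)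

lemma mem_obox (p : R3) : p ∈ obox ↔ (0 < p 0 ∧ p 0 < 1) ∧ (-π < p 1 ∧ p 1 < π) ∧
    (-π < p 2 ∧ p 2 < π) := by
  simp [obox, Fin.forall_fin_succ]

lemma polar_inj {r s t u : ℝ} (hr : 0 < r) (hs : 0 < s) (ht : -π < t ∧ t < π)
    (hu : -π < u ∧ u < π) (h1 : r * Real.cos t = s * Real.cos u)
    (h2 : r * Real.sin t = s * Real.sin u) : r = s ∧ t = u := by
  have hinj := polarCoord.symm.injOn (x₁ := (r, t)) (x₂ := (s, u))
    (by simpa [hr] using ht) (by simpa [hs] using hu) (by simp [h1, h2])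
  simpa using hinj

lemma tX_injOn (a : ℝ) (ha : 1 < a) : InjOn (tX a) obox := by
  intro p hp q hq h
  rw [mem_obox] at hp hq
  have e1 := (rad_tX a ha p hp.1.1.le hp.1.2.le)
  have e2 := (rad_tX a ha q hq.1.1.le hq.1.2.le)
  have h0 := congrFun h 0
  have h1 := congrFun h 1
  have h2 := congrFun h 2
  simp [tX] at h0 h1 h2
  obtain ⟨k1, k2⟩ := polar_inj e1.2 e2.2 hp.2.2 hq.2.2 h0 h1
  obtain ⟨k3, k4⟩ := polar_inj hp.1.1 hq.1.1 hp.2.1 hq.2.1 (by linarith) h2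
  ext i; fin_cases i
  · exact k3
  · exact k4
  · exact k2

lemma coord_null (i : Fin 3) : volume {x : R3 | x i = 0} = 0 := by
  have := Measure.addHaar_submodule (volume : Measure R3)
    (LinearMap.ker (LinearMap.proj i : R3 →ₗ[ℝ] ℝ)) ?_
  · have e : {x : R3 | x i = 0} = (LinearMap.ker (LinearMap.proj i : R3 →ₗ[ℝ] ℝ) : Set R3) := by
      ext x; simp
    rw [e]; exact this
  · intro h
    rw [LinearMap.ker_eq_top] at h
    have := LinearMap.congr_fun h (fun _ => 1)
    simp at this

lemma tX_image_ae (a : ℝ) (ha : 1 < a) : tX a '' obox =ᵐ[volume] torus a := by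
  have h1 : tX a '' obox ⊆ torus a := by
    rintro _ ⟨p, hp, rfl⟩
    rw [mem_obox] at hp
    exact tX_mem_torus a ha p hp.1.1.le hp.1.2
  refine (LE.le.eventuallyLE h1).antisymm ?_
  have : ∀ i : Fin 3, ∀ᵐ x : R3, x i ≠ 0 := fun i => by
    rw [ae_iff]; simpa using coord_null i
  filter_upwards [this 1, this 2] with x k1 k2 hx
  obtain ⟨p, e0, e1, -, -, e2, e3⟩ := tX_surj a x
  refine ⟨p, ?_, e0⟩
  rw [mem_obox]
  refine ⟨⟨?_, ?_⟩, e2 k2, e3 k1⟩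
  · rw [e1]; positivity
  · rw [e1, Real.sqrt_lt' (by norm_num)]
    have hx' : (a - rad x) ^ 2 + (x 2) ^ 2 < 1 := hx
    linarith [sq_nonneg (rad x - a)]

open scoped Topology

lemma fderiv_bdd {E : Type*} [NormedAddCommGroup E] [NormedSpace ℝ E] {f : E → ℝ} {s K : Set E}
    (hf : ContDiffOn ℝ 1 f s) (hK : IsCompact K) (hKs : K ⊆ s) :
    ∃ C, ∀ y ∈ K ∩ interior s, ‖fderiv ℝ f y‖ ≤ C := by
  refine hK.induction_on (p := fun t => ∃ C, ∀ y ∈ t ∩ interior s, ‖fderiv ℝ f y‖ ≤ C)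
    ⟨0, by simp⟩ ?_ ?_ ?_
  · rintro t u htu ⟨C, hC⟩
    exact ⟨C, fun y hy => hC y ⟨htu hy.1, hy.2⟩⟩
  · rintro t u ⟨C, hC⟩ ⟨C', hC'⟩
    refine ⟨max C C', fun y hy => ?_⟩
    rcases hy.1 with h | h
    · exact (hC y ⟨h, hy.2⟩).trans (le_max_left _ _)
    · exact (hC' y ⟨h, hy.2⟩).trans (le_max_right _ _)
  · intro x hx
    have h1 := hf x (hKs hx)
    rw [show (1 : WithTop ℕ∞) = 0 + 1 by simp,
      contDiffWithinAt_succ_iff_hasFDerivWithinAt (by simp)] at h1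
    obtain ⟨u, hu, -, f', hf', hc⟩ := h1
    rw [insert_eq_of_mem (hKs hx)] at hu
    have hxu : x ∈ u := mem_of_mem_nhdsWithin (hKs hx) hu
    have hb : ∀ᶠ y in 𝓝[u] x, ‖f' y‖ < ‖f' x‖ + 1 :=
      hc.continuousWithinAt.norm.eventually (gt_mem_nhds (by linarith))
    obtain ⟨O, hO, hxO, hOu⟩ := mem_nhdsWithin.1 hu
    obtain ⟨O', hO', hxO', hOu'⟩ := mem_nhdsWithin.1 hb
    refine ⟨O ∩ O', mem_nhdsWithin_of_mem_nhds ((hO.inter hO').mem_nhds ⟨hxO, hxO'⟩),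
      ‖f' x‖ + 1, ?_⟩
    rintro y ⟨⟨hy1, hy2⟩, hy3⟩
    have hyu : y ∈ u := hOu ⟨hy1, interior_subset hy3⟩
    have hun : u ∈ 𝓝 y := by
      filter_upwards [hO.mem_nhds hy1, isOpen_interior.mem_nhds hy3] with z h1 h2
      exact hOu ⟨h1, interior_subset h2⟩
    rw [((hf' y hyu).hasFDerivAt hun).fderiv]
    exact le_of_lt (hOu' ⟨hy2, hyu⟩)

lemma pd_aux (F : R3 → ℝ) (p : R3) (hF : DifferentiableAt ℝ F p) (j : Fin 3)
    (A B C D E G H : ℝ)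
    (h : ∀ t, F (Function.update p j t) = A + B * t + C * t ^ 2 + D * Real.cos t + E * Real.sin t
      + G * Real.cos t ^ 2 + H * (Real.sin t * Real.cos t)) :
    fderiv ℝ F p (Pi.single j 1) = B + 2 * C * p j - D * Real.sin (p j) + E * Real.cos (p j)
      - 2 * G * Real.sin (p j) * Real.cos (p j) + H * (Real.cos (p j) ^ 2 - Real.sin (p j) ^ 2) := by
  have h1 : HasDerivAt (fun t => F (Function.update p j t)) (fderiv ℝ F p (Pi.single j 1)) (p j) := by
    have h2 : HasFDerivAt F (fderiv ℝ F p) (Function.update p j (p j)) := by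
      simpa using hF.hasFDerivAt
    exact h2.comp_hasDerivAt (p j) (hasDerivAt_update p j (p j))
  have h3 : HasDerivAt (fun t => F (Function.update p j t)) (B + 2 * C * p j - D * Real.sin (p j) + E * Real.cos (p j)
      - 2 * G * Real.sin (p j) * Real.cos (p j) + H * (Real.cos (p j) ^ 2 - Real.sin (p j) ^ 2)) (p j) := by
    simp only [h]
    have hc := Real.hasDerivAt_cos (p j)
    have hs := Real.hasDerivAt_sin (p j)
    have hi := hasDerivAt_id (p j)
    have := ((((((hi.const_mul B).const_add A).add ((hi.pow 2).const_mul C)).add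
      (hc.const_mul D)).add (hs.const_mul E)).add ((hc.pow 2).const_mul G)).add
      ((hs.mul hc).const_mul H)
    exact this.congr_deriv (by simp; ring)
  exact h1.unique h3

/-- The Piola-transformed constant vector field `w`. -/
def cf (a : ℝ) (w : R3) : Fin 3 → R3 → ℝ :=
  ![fun p => p 0 * (a + p 0 * Real.cos (p 1)) *
      (w 0 * (Real.cos (p 1) * Real.cos (p 2)) + w 1 * (Real.cos (p 1) * Real.sin (p 2))
        + w 2 * Real.sin (p 1)),
    fun p => (a + p 0 * Real.cos (p 1)) *
      (-(w 0 * (Real.sin (p 1) * Real.cos (p 2))) - w 1 * (Real.sin (p 1) * Real.sin (p 2))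
        + w 2 * Real.cos (p 1)),
    fun p => p 0 * (-(w 0 * Real.sin (p 2)) + w 1 * Real.cos (p 2))]

lemma cf_diff (a : ℝ) (w : R3) (i : Fin 3) : Differentiable ℝ (cf a w i) := by
  fin_cases i <;> simp [cf] <;> fun_prop

lemma cf_div (a : ℝ) (w p : R3) : ∑ i, fderiv ℝ (cf a w i) p (Pi.single i 1) = 0 := by
  rw [Fin.sum_univ_three]
  rw [pd_aux (cf a w 0) p (cf_diff a w 0 p) 0 0 (a * (w 0 * (Real.cos (p 1) * Real.cos (p 2)) + w 1 * (Real.cos (p 1) * Real.sin (p 2))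
        + w 2 * Real.sin (p 1))) (Real.cos (p 1) * (w 0 * (Real.cos (p 1) * Real.cos (p 2)) + w 1 * (Real.cos (p 1) * Real.sin (p 2))
        + w 2 * Real.sin (p 1))) 0 0 0 0 (by intro t; simp [cf]; ring)]
  rw [pd_aux (cf a w 1) p (cf_diff a w 1 p) 1 0 0 0 (a * w 2) (-a * (w 0 * Real.cos (p 2) + w 1 * Real.sin (p 2)))
    (p 0 * w 2) (-p 0 * (w 0 * Real.cos (p 2) + w 1 * Real.sin (p 2))) (by intro t; simp [cf]; ring)]
  rw [pd_aux (cf a w 2) p (cf_diff a w 2 p) 2 0 0 0 (p 0 * w 1) (-p 0 * w 0) 0 0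
    (by intro t; simp [cf]; ring)]
  linear_combination (p 0 * (w 0 * Real.cos (p 2) + w 1 * Real.sin (p 2))) * Real.sin_sq_add_cos_sq (p 1)

lemma tX_diff (a : ℝ) : Differentiable ℝ (tX a) := (tX_contDiff a).differentiable (by simp)

lemma tX_comp (a : ℝ) (p v : R3) (i : Fin 3) :
    fderiv ℝ (tX a) p v i = fderiv ℝ (fun q => tX a q i) p v := by
  have := (hasFDerivAt_pi'.1 (tX_diff a p).hasFDerivAt) i
  rw [this.fderiv]; rfl

lemma tX_comp_diff (a : ℝ) (p : R3) (i : Fin 3) : DifferentiableAt ℝ (fun q => tX a q i) p :=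
  differentiableAt_pi.1 (tX_diff a p) i

lemma tX_d0 (a : ℝ) (p : R3) : fderiv ℝ (tX a) p (Pi.single 0 1) =
    ![Real.cos (p 1) * Real.cos (p 2), Real.cos (p 1) * Real.sin (p 2), Real.sin (p 1)] := by
  ext i
  rw [tX_comp]
  fin_cases i
  · rw [pd_aux _ p (tX_comp_diff a p _) 0 (a * Real.cos (p 2)) (Real.cos (p 1) * Real.cos (p 2)) 0 0 0 0 0
      (by intro t; simp [tX]; ring)]; simp
  · rw [pd_aux _ p (tX_comp_diff a p _) 0 (a * Real.sin (p 2)) (Real.cos (p 1) * Real.sin (p 2)) 0 0 0 0 0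
      (by intro t; simp [tX]; ring)]; simp
  · rw [pd_aux _ p (tX_comp_diff a p _) 0 0 (Real.sin (p 1)) 0 0 0 0 0
      (by intro t; simp [tX]; ring)]; simp

lemma tX_d1 (a : ℝ) (p : R3) : fderiv ℝ (tX a) p (Pi.single 1 1) =
    ![-(p 0 * Real.sin (p 1) * Real.cos (p 2)), -(p 0 * Real.sin (p 1) * Real.sin (p 2)),
      p 0 * Real.cos (p 1)] := by
  ext i
  rw [tX_comp]
  fin_cases i
  · rw [pd_aux _ p (tX_comp_diff a p _) 1 (a * Real.cos (p 2)) 0 0 (p 0 * Real.cos (p 2)) 0 0 0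
      (by intro t; simp [tX]; ring)]; simp; ring
  · rw [pd_aux _ p (tX_comp_diff a p _) 1 (a * Real.sin (p 2)) 0 0 (p 0 * Real.sin (p 2)) 0 0 0
      (by intro t; simp [tX]; ring)]; simp; ring
  · rw [pd_aux _ p (tX_comp_diff a p _) 1 0 0 0 0 (p 0) 0 0
      (by intro t; simp [tX])]; simp

lemma tX_d2 (a : ℝ) (p : R3) : fderiv ℝ (tX a) p (Pi.single 2 1) =
    ![-((a + p 0 * Real.cos (p 1)) * Real.sin (p 2)), (a + p 0 * Real.cos (p 1)) * Real.cos (p 2),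
      0] := by
  ext i
  rw [tX_comp]
  fin_cases i
  · rw [pd_aux _ p (tX_comp_diff a p _) 2 0 0 0 (a + p 0 * Real.cos (p 1)) 0 0 0
      (by intro t; simp [tX])]; simp
  · rw [pd_aux _ p (tX_comp_diff a p _) 2 0 0 0 0 (a + p 0 * Real.cos (p 1)) 0 0
      (by intro t; simp [tX])]; simp
  · rw [pd_aux _ p (tX_comp_diff a p _) 2 (p 0 * Real.sin (p 1)) 0 0 0 0 0 0
      (by intro t; simp [tX])]; simp

lemma tX_det (a : ℝ) (p : R3) : (fderiv ℝ (tX a) p).det = -(p 0 * (a + p 0 * Real.cos (p 1))) := by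
  have h : (fderiv ℝ (tX a) p).det =
      (LinearMap.toMatrix' ((fderiv ℝ (tX a) p) : R3 →ₗ[ℝ] R3)).det := by
    rw [LinearMap.det_toMatrix']
  have e : ∀ i j, LinearMap.toMatrix' ((fderiv ℝ (tX a) p) : R3 →ₗ[ℝ] R3) i j
      = fderiv ℝ (tX a) p (Pi.single j 1) i := by
    intro i j
    rw [LinearMap.toMatrix'_apply]
    congr 2
  rw [h, Matrix.det_fin_three]
  simp only [e, tX_d0, tX_d1, tX_d2]
  simp
  linear_combination (-(p 0 * (a + p 0 * Real.cos (p 1)))) * (Real.sin_sq_add_cos_sq (p 1)) +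
    (-(p 0 * (a + p 0 * Real.cos (p 1))) * Real.cos (p 1) ^ 2
     - (p 0 * (a + p 0 * Real.cos (p 1))) * Real.sin (p 1) ^ 2) * (Real.sin_sq_add_cos_sq (p 2))

lemma cf_vec (a : ℝ) (w p : R3) :
    ∑ i, cf a w i p • fderiv ℝ (tX a) p (Pi.single i 1) = (p 0 * (a + p 0 * Real.cos (p 1))) • w := by
  rw [Fin.sum_univ_three, tX_d0, tX_d1, tX_d2]
  have h1 := Real.sin_sq (p 1)
  have h2 := Real.sin_sq (p 2)
  ext i
  fin_cases i <;> simp [cf] <;> ring_nf <;> simp only [h1, h2] <;> ring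

lemma integrableOn_torus (a : ℝ) (ha : 1 < a) (f : R3 → ℝ)
    (hf : ContDiffOn ℝ 1 f (closure (torus a))) (w : R3) :
    IntegrableOn (fun x => fderiv ℝ f x w) (torus a) := by
  obtain ⟨C, hC⟩ := fderiv_bdd hf (torus_compact a ha) subset_rfl
  have hsub : torus a ⊆ closure (torus a) ∩ interior (closure (torus a)) := fun x hx =>
    ⟨subset_closure hx, (torus_open a).subset_interior_iff.2 subset_closure hx⟩
  have hfin : volume (torus a) < ⊤ :=
    (measure_mono subset_closure).trans_lt (torus_compact a ha).measure_lt_top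
  have hco : ContinuousOn (fun x => fderiv ℝ f x w) (torus a) :=
    ((hf.mono subset_closure).continuousOn_fderiv_of_isOpen (torus_open a) le_rfl).clm_apply
      continuousOn_const
  refine IntegrableOn.of_bound hfin
    (hco.aestronglyMeasurable (torus_open a).measurableSet) (C * ‖w‖) ?_
  refine (ae_restrict_iff' (torus_open a).measurableSet).2 (Eventually.of_forall fun x hx => ?_)
  exact ((fderiv ℝ f x).le_opNorm w).trans
    (mul_le_mul_of_nonneg_right (hC x (hsub hx)) (norm_nonneg _))

lemma div_torus (a : ℝ) (ha : 1 < a) (f : R3 → ℝ)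
    (hf : ContDiffOn ℝ 1 f (closure (torus a))) (w : R3) :
    ∫ x in torus a, fderiv ℝ f x w =
      ∫ y in Icc (fun _ => -π : Fin 2 → ℝ) (fun _ => π),
        (a + Real.cos (y 0)) * dot w (bn y) * f (bX a y) := by
  have hob : MeasurableSet obox :=
    MeasurableSet.univ_pi fun i => measurableSet_Ioo
  have hder : ∀ x ∈ obox, HasFDerivWithinAt (tX a) (fderiv ℝ (tX a) x) obox x := fun x _ =>
    (tX_diff a x).hasFDerivAt.hasFDerivWithinAt
  have hdet : ∀ p ∈ obox, |(fderiv ℝ (tX a) p).det| = p 0 * (a + p 0 * Real.cos (p 1)) := by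
    intro p hp
    rw [mem_obox] at hp
    have := (rad_tX a ha p hp.1.1.le hp.1.2.le).2
    rw [tX_det, abs_neg, abs_of_nonneg (mul_nonneg hp.1.1.le this.le)]
  have hfd : ∀ x ∈ torus a, DifferentiableAt ℝ f x := fun x hx =>
    ((hf.mono subset_closure).differentiableOn (by simp) x hx).differentiableAt
      ((torus_open a).mem_nhds hx)
  -- change of variables
  have hI := integrableOn_torus a ha f hf w
  have hI2 : IntegrableOn (fun x => fderiv ℝ f x w) (tX a '' obox) :=
    hI.congr_set_ae (tX_image_ae a ha)
  rw [integrableOn_image_iff_integrableOn_abs_det_fderiv_smul volume hob hder (tX_injOn a ha)] at hI2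
  rw [← setIntegral_congr_set (tX_image_ae a ha),
    integral_image_eq_integral_abs_det_fderiv_smul volume hob hder (tX_injOn a ha)]
  -- divergence form
  set f' : Fin 3 → R3 → R3 →L[ℝ] ℝ := fun i p =>
    cf a w i p • ((fderiv ℝ f (tX a p)).comp (fderiv ℝ (tX a) p)) + f (tX a p) • fderiv ℝ (cf a w i) p
    with hf'
  have hsum : ∀ p, ∑ i, f' i p (Pi.single i 1) =
      fderiv ℝ f (tX a p) ((p 0 * (a + p 0 * Real.cos (p 1))) • w) := by
    intro p
    rw [← cf_vec, map_sum]
    simp only [hf', add_apply, smul_apply,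
      ContinuousLinearMap.comp_apply, Finset.sum_add_distrib, map_smul]
    rw [← Finset.smul_sum, cf_div]
    simp
  have hae : obox =ᵐ[volume] Icc (![0, -π, -π] : R3) (![1, π, π] : R3) :=
    Measure.univ_pi_Ioo_ae_eq_Icc
  have hcongr : ∀ p ∈ obox, |(fderiv ℝ (tX a) p).det| • fderiv ℝ f (tX a p) w =
      ∑ i, f' i p (Pi.single i 1) := by
    intro p hp
    rw [hsum, hdet p hp, map_smul]
  have hpi := Real.pi_pos
  have hle : (![0, -π, -π] : R3) ≤ ![1, π, π] := by
    intro i; fin_cases i <;> simp <;> linarith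
  have key := integral_divergence_of_hasFDerivAt_off_countable' (![0, -π, -π] : R3) ![1, π, π] hle
    (fun i p => cf a w i p * f (tX a p)) f' ∅ countable_empty ?_ ?_ ?_
  · rw [setIntegral_congr_fun hob hcongr, setIntegral_congr_set hae, key]
    have e1 : (![0, -π, -π] : R3) ∘ (0 : Fin 3).succAbove = fun _ => -π := by
      ext i; fin_cases i <;> rfl
    have e2 : (![1, π, π] : R3) ∘ (0 : Fin 3).succAbove = fun _ => π := by
      ext i; fin_cases i <;> rfl
    have i0 : ∀ (c : ℝ) (y : Fin 2 → ℝ), Fin.insertNth (α := fun _ => ℝ) (0 : Fin 3) c y = ![c, y 0, y 1] := by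
      intro c y; ext i; fin_cases i <;> rfl
    have i1 : ∀ (c : ℝ) (y : Fin 2 → ℝ), Fin.insertNth (α := fun _ => ℝ) (1 : Fin 3) c y = ![y 0, c, y 1] := by
      intro c y; ext i; fin_cases i <;> rfl
    have i2 : ∀ (c : ℝ) (y : Fin 2 → ℝ), Fin.insertNth (α := fun _ => ℝ) (2 : Fin 3) c y = ![y 0, y 1, c] := by
      intro c y; ext i; fin_cases i <;> rfl
    rw [Fin.sum_univ_three]
    simp only [e1, e2, i0, i1, i2]
    have z0 : ∀ y : Fin 2 → ℝ, cf a w 0 ![(![0, -π, -π] : R3) 0, y 0, y 1] = 0 := by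
      intro y; simp [cf]
    have z1 : ∀ y : Fin 2 → ℝ, cf a w 1 ![y 0, (![1, π, π] : R3) 1, y 1] =
        cf a w 1 ![y 0, (![0, -π, -π] : R3) 1, y 1] := by
      intro y; simp [cf]
    have z1' : ∀ y : Fin 2 → ℝ, tX a ![y 0, (![1, π, π] : R3) 1, y 1] =
        tX a ![y 0, (![0, -π, -π] : R3) 1, y 1] := by
      intro y; simp [tX]
    have z2 : ∀ y : Fin 2 → ℝ, cf a w 2 ![y 0, y 1, (![1, π, π] : R3) 2] =
        cf a w 2 ![y 0, y 1, (![0, -π, -π] : R3) 2] := by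
      intro y; simp [cf]
    have z2' : ∀ y : Fin 2 → ℝ, tX a ![y 0, y 1, (![1, π, π] : R3) 2] =
        tX a ![y 0, y 1, (![0, -π, -π] : R3) 2] := by
      intro y; simp [tX]
    simp only [z0, z1, z1', z2, z2', zero_mul, integral_zero, sub_self, add_zero, sub_zero]
    congr 1
    ext y
    have : cf a w 0 ![(![1, π, π] : R3) 0, y 0, y 1] = (a + Real.cos (y 0)) * dot w (bn y) := by
      simp [cf, dot, bn, Fin.sum_univ_three]
    rw [this]
    rfl
  · intro i
    refine ((cf_diff a w i).continuous.continuousOn).mul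
      (hf.continuousOn.comp (tX_cont a).continuousOn ?_)
    intro p hp
    have h1 := hp.1 0
    have h2 := hp.2 0
    exact tX_mem_closure a ha p (by simpa using h1) (by simpa using h2)
  · intro p hp i
    have hp' : p ∈ obox := hp.1
    have hp2 := hp'
    rw [mem_obox] at hp2
    have hm := hfd _ (tX_mem_torus a ha p hp2.1.1.le hp2.1.2)
    exact ((cf_diff a w i p).hasFDerivAt).mul (hm.hasFDerivAt.comp p (tX_diff a p).hasFDerivAt)
  · refine IntegrableOn.congr_set_ae ?_ hae.symm
    exact hI2.congr_fun hcongr hob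

lemma nsq_contDiff : ContDiff ℝ 1 nsq := by unfold nsq; fun_prop

lemma nsq_nonneg (v : R3) : 0 ≤ nsq v := Finset.sum_nonneg fun _ _ => sq_nonneg _

lemma vb_pos (v : R3) : 0 < vb v := Real.sqrt_pos.2 (by linarith [nsq_nonneg v])

lemma vb_contDiff : ContDiff ℝ 1 vb := by
  have := nsq_contDiff
  exact ContDiff.sqrt (by fun_prop) fun v => by linarith [nsq_nonneg v]

lemma vhat_contDiff : ContDiff ℝ 1 vhat := by
  rw [contDiff_pi]
  intro i
  exact ContDiff.div (by fun_prop) vb_contDiff fun v => (vb_pos v).ne'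

lemma vhat_cont : Continuous vhat := vhat_contDiff.continuous

lemma nsq_fderiv (v : R3) (i : Fin 3) : fderiv ℝ nsq v (Pi.single i 1) = 2 * v i := by
  have : HasFDerivAt nsq (∑ j : Fin 3, (2 * v j) • (ContinuousLinearMap.proj j : R3 →L[ℝ] ℝ)) v := by
    unfold nsq
    refine HasFDerivAt.fun_sum fun j _ => ?_
    simpa using ((ContinuousLinearMap.proj j : R3 →L[ℝ] ℝ).hasFDerivAt (x := v)).pow 2
  rw [this.fderiv]
  fin_cases i <;> simp [Fin.sum_univ_three]

lemma vhat_symm (v : R3) (i j : Fin 3) :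
    fderiv ℝ (fun w => vhat w j) v (Pi.single i 1) =
      fderiv ℝ (fun w => vhat w i) v (Pi.single j 1) := by
  have hφ : DifferentiableAt ℝ (fun s : ℝ => (Real.sqrt (1 + s))⁻¹) (nsq v) := by
    have h0 := nsq_nonneg v
    have h1 : 0 < Real.sqrt (1 + nsq v) := vb_pos v
    have h2 : DifferentiableAt ℝ (fun s : ℝ => Real.sqrt (1 + s)) (nsq v) :=
      DifferentiableAt.sqrt (by fun_prop) (by linarith)
    exact h2.inv h1.ne'
  have hn : HasFDerivAt nsq (fderiv ℝ nsq v) v :=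
    (nsq_contDiff.differentiable (by simp) v).hasFDerivAt
  have hc := hφ.hasDerivAt.comp_hasFDerivAt v hn
  have key : ∀ i j : Fin 3, fderiv ℝ (fun w => vhat w j) v (Pi.single i 1) =
      (vb v)⁻¹ * (Pi.single i 1 : R3) j +
        v j * (deriv (fun s : ℝ => (Real.sqrt (1 + s))⁻¹) (nsq v) * (2 * v i)) := by
    intro i j
    have h := ((ContinuousLinearMap.proj j : R3 →L[ℝ] ℝ).hasFDerivAt (x := v)).mul hc
    have h' : HasFDerivAt (fun w => vhat w j) _ v := h
    rw [h'.fderiv]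
    simp [nsq_fderiv, vb]
    ring
  rw [key, key]
  rcases eq_or_ne i j with rfl | hij
  · rfl
  · simp [hij, hij.symm]; ring

/-- velocity part of the characteristic field -/
def Wf (E B v : R3) : R3 := fun i => E i + cross (vhat v) B i

lemma Wf_div (E B v : R3) : ∑ i, fderiv ℝ (fun w => Wf E B w i) v (Pi.single i 1) = 0 := by
  have h : ∀ j, HasFDerivAt (fun w => vhat w j) (fderiv ℝ (fun w => vhat w j) v) v := fun j =>
    (differentiableAt_pi.1 (vhat_contDiff.differentiable (by simp) v) j).hasFDerivAt
  have h0 : HasFDerivAt (fun w => Wf E B w 0) _ v :=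
    (((h 1).mul_const (B 2)).sub ((h 2).mul_const (B 1))).const_add (E 0)
  have h1 : HasFDerivAt (fun w => Wf E B w 1) _ v :=
    (((h 2).mul_const (B 0)).sub ((h 0).mul_const (B 2))).const_add (E 1)
  have h2 : HasFDerivAt (fun w => Wf E B w 2) _ v :=
    (((h 0).mul_const (B 1)).sub ((h 1).mul_const (B 0))).const_add (E 2)
  rw [Fin.sum_univ_three, h0.fderiv, h1.fderiv, h2.fderiv]
  simp only [sub_apply, smul_apply, smul_eq_mul]
  rw [vhat_symm v 1 0, vhat_symm v 2 0, vhat_symm v 2 1]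
  ring

lemma Wf_contDiff (E B : R3) (i : Fin 3) : ContDiff ℝ 1 (fun w => Wf E B w i) := by
  have := contDiff_pi.1 vhat_contDiff
  fin_cases i <;> simp [Wf, cross] <;> fun_prop

lemma clm_expand (L : R3 →L[ℝ] ℝ) (w : R3) : L w = ∑ i, w i * L (Pi.single i 1) := by
  conv_lhs => rw [show w = ∑ i, w i • (Pi.single i 1 : R3) by
    ext j; fin_cases j <;> simp [Fin.sum_univ_three]]
  simp [map_sum]

lemma v_part (E B : R3) (k : R3 → ℝ) (hk : ContDiff ℝ 1 k) (hs : HasCompactSupport k) :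
    ∫ v, fderiv ℝ k v (Wf E B v) = 0 := by
  have hk' : Continuous (fderiv ℝ k) := hk.continuous_fderiv (by simp)
  have hs' : HasCompactSupport (fderiv ℝ k) := hs.fderiv (𝕜 := ℝ)
  have hi : ∀ i : Fin 3, Integrable (fun v => Wf E B v i * fderiv ℝ k v (Pi.single i 1)) := by
    intro i
    have h1 : Continuous (fun v => Wf E B v i) := (Wf_contDiff E B i).continuous
    refine Continuous.integrable_of_hasCompactSupport (by fun_prop) ?_
    refine HasCompactSupport.mul_left (f := fun v => Wf E B v i) ?_
    exact hs'.comp_left (g := fun L : R3 →L[ℝ] ℝ => L (Pi.single i 1)) rfl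
  have hi2 : ∀ i : Fin 3, Integrable
      (fun v => fderiv ℝ (fun w => Wf E B w i) v (Pi.single i 1) * k v) := by
    intro i
    have h1 : Continuous (fderiv ℝ (fun v => Wf E B v i)) :=
      (Wf_contDiff E B i).continuous_fderiv (by simp)
    have h2 := hk.continuous
    exact Continuous.integrable_of_hasCompactSupport (by fun_prop) (HasCompactSupport.mul_left hs)
  have hi3 : ∀ i : Fin 3, Integrable (fun v => Wf E B v i * k v) := by
    intro i
    have h1 : Continuous (fun v => Wf E B v i) := (Wf_contDiff E B i).continuous
    have h2 := hk.continuous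
    exact Continuous.integrable_of_hasCompactSupport (by fun_prop) (HasCompactSupport.mul_left hs)
  simp_rw [fun v => clm_expand (fderiv ℝ k v) (Wf E B v)]
  rw [integral_finsetSum _ fun i _ => hi i]
  have : ∀ i : Fin 3, ∫ v, Wf E B v i * fderiv ℝ k v (Pi.single i 1) =
      - ∫ v, fderiv ℝ (fun w => Wf E B w i) v (Pi.single i 1) * k v := fun i =>
    integral_mul_fderiv_eq_neg_fderiv_mul_of_integrable (hi2 i) (hi i) (hi3 i)
      (fun x _ => (Wf_contDiff E B i).differentiable (by simp) x)
      (fun x _ => hk.differentiable (by simp) x)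
  simp_rw [this]
  rw [Finset.sum_neg_distrib, ← integral_finsetSum _ fun i _ => hi2 i]
  simp_rw [← Finset.sum_mul, Wf_div]
  simp

/-- reflection as a linear map -/
def reflL (n : R3) : R3 →ₗ[ℝ] R3 where
  toFun v := fun i => v i - 2 * dot v n * n i
  map_add' u v := by ext i; simp [dot, Fin.sum_univ_three]; ring
  map_smul' c v := by ext i; simp [dot, Fin.sum_univ_three]; ring

lemma reflL_dot (n : R3) (hn : dot n n = 1) (v : R3) : dot (reflL n v) n = - dot v n := by
  simp only [reflL, dot, Fin.sum_univ_three, LinearMap.coe_mk, AddHom.coe_mk] at *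
  linear_combination (-2 * (v 0 * n 0 + v 1 * n 1 + v 2 * n 2)) * hn

lemma reflL_nsq (n : R3) (hn : dot n n = 1) (v : R3) : nsq (reflL n v) = nsq v := by
  simp only [reflL, dot, nsq, Fin.sum_univ_three, LinearMap.coe_mk, AddHom.coe_mk] at *
  linear_combination (4 * (v 0 * n 0 + v 1 * n 1 + v 2 * n 2) ^ 2) * hn

lemma reflL_invol (n : R3) (hn : dot n n = 1) (v : R3) : reflL n (reflL n v) = v := by
  ext i
  have h := reflL_dot n hn v
  change reflL n v i - 2 * dot (reflL n v) n * n i = v i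
  rw [h]
  simp only [reflL, LinearMap.coe_mk, AddHom.coe_mk]
  ring

lemma reflL_integral (n : R3) (hn : dot n n = 1) (F : R3 → ℝ) :
    ∫ v, F (reflL n v) = ∫ v, F v := by
  have hcomp : reflL n ∘ₗ reflL n = LinearMap.id := by
    ext1; ext1; simp [reflL_invol n hn]
  have hd : LinearMap.det (reflL n) * LinearMap.det (reflL n) = 1 := by
    rw [← LinearMap.det_comp, hcomp, LinearMap.det_id]
  have hd0 : LinearMap.det (reflL n) ≠ 0 := by intro h; simp [h] at hd
  have habs : |(LinearMap.det (reflL n))⁻¹| = 1 := by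
    rcases mul_self_eq_one_iff.1 hd with h | h <;> simp [h]
  have hmap := Measure.map_linearMap_addHaar_eq_smul_addHaar (volume : Measure R3) hd0
  rw [habs] at hmap
  simp at hmap
  have hemb : MeasurableEmbedding (reflL n) :=
    (LinearEquiv.toContinuousLinearEquiv (LinearEquiv.ofInvolutive (reflL n)
      (reflL_invol n hn))).toHomeomorph.measurableEmbedding
  have := hemb.integral_map (μ := volume) F
  rw [← this, hmap]

open scoped Topology

/-- phase space closure -/
def phS (a : ℝ) : Set (R3 × R3) := (closure (torus a)) ×ˢ (univ : Set R3)

lemma torus_prod_open (a : ℝ) : IsOpen (torus a ×ˢ (univ : Set R3)) :=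
  (torus_open a).prod isOpen_univ

lemma torus_prod_sub (a : ℝ) : torus a ×ˢ (univ : Set R3) ⊆ phS a :=
  prod_mono subset_closure subset_rfl

lemma phS_nhds (a : ℝ) {q : R3 × R3} (hq : q.1 ∈ torus a) : phS a ∈ 𝓝 q :=
  mem_of_superset ((torus_prod_open a).mem_nhds ⟨hq, mem_univ _⟩) (torus_prod_sub a)

lemma phS_diff (a : ℝ) {f : R3 × R3 → ℝ} (hf : ContDiffOn ℝ 1 f (phS a)) {q : R3 × R3}
    (hq : q.1 ∈ torus a) : DifferentiableAt ℝ f q :=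
  (hf.differentiableOn (by simp) q (mem_of_mem_nhds (phS_nhds a hq))).differentiableAt
    (phS_nhds a hq)

lemma int_lemma (a : ℝ) (ha : 1 < a) (f u : R3 × R3 → ℝ) (Z : R3 × R3 → R3 × R3)
    (hf : ContDiffOn ℝ 1 f (phS a)) (hu : ContinuousOn u (phS a)) (hZ : ContinuousOn Z (phS a))
    (R : ℝ) (hz : ∀ q : R3 × R3, R < ‖q.2‖ → u q * fderiv ℝ f q (Z q) = 0) :
    Integrable (fun q => u q * fderiv ℝ f q (Z q)) ((volume.restrict (torus a)).prod volume) := by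
  have hμ : (volume.restrict (torus a)).prod (volume : Measure R3) =
      ((volume : Measure R3).prod (volume : Measure R3)).restrict (torus a ×ˢ univ) := by
    rw [← Measure.prod_restrict, Measure.restrict_univ]
  rw [hμ]
  set K : Set (R3 × R3) := closure (torus a) ×ˢ Metric.closedBall 0 R with hKdef
  have hK : IsCompact K := (torus_compact a ha).prod (isCompact_closedBall _ _)
  have hKs : K ⊆ phS a := prod_mono subset_rfl (subset_univ _)
  obtain ⟨C, hC⟩ := fderiv_bdd hf hK hKs
  obtain ⟨C1, hC1⟩ := hK.exists_bound_of_continuousOn (hu.mono hKs)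
  obtain ⟨C2, hC2⟩ := hK.exists_bound_of_continuousOn (hZ.mono hKs)
  have hTm : MeasurableSet (torus a ×ˢ (univ : Set R3)) := (torus_prod_open a).measurableSet
  have hTb : MeasurableSet (torus a ×ˢ (Metric.closedBall 0 R : Set R3)) :=
    (torus_open a).measurableSet.prod measurableSet_closedBall
  have hco : ContinuousOn (fun q => u q * fderiv ℝ f q (Z q)) (torus a ×ˢ (univ : Set R3)) :=
    (hu.mono (torus_prod_sub a)).mul
      (((hf.mono (torus_prod_sub a)).continuousOn_fderiv_of_isOpen (torus_prod_open a)
        le_rfl).clm_apply (hZ.mono (torus_prod_sub a)))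
  have hsub : torus a ×ˢ (Metric.closedBall 0 R : Set R3) ⊆ K := prod_mono subset_closure subset_rfl
  have hIntg : IntegrableOn (fun q => u q * fderiv ℝ f q (Z q))
      (torus a ×ˢ (Metric.closedBall 0 R : Set R3))
      ((volume : Measure R3).prod (volume : Measure R3)) := by
    refine IntegrableOn.of_bound ((measure_mono hsub).trans_lt hK.measure_lt_top)
      ((hco.mono (prod_mono subset_rfl (subset_univ _))).aestronglyMeasurable hTb)
      (C1 * (C * C2)) ?_
    refine (ae_restrict_iff' hTb).2 (Eventually.of_forall fun q hq => ?_)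
    have h1 := hC1 q (hsub hq)
    have h2 := hC2 q (hsub hq)
    have h3 := hC q ⟨hsub hq, mem_interior_iff_mem_nhds.2 (phS_nhds a hq.1)⟩
    rw [norm_mul]
    have h4 := (fderiv ℝ f q).le_opNorm (Z q)
    have h5 : ‖fderiv ℝ f q (Z q)‖ ≤ C * C2 := h4.trans
      (mul_le_mul h3 h2 (norm_nonneg _) ((norm_nonneg _).trans h3))
    exact mul_le_mul h1 h5 (norm_nonneg _) ((norm_nonneg _).trans h1)
  refine IntegrableOn.of_forall_sdiff_eq_zero hIntg hTm ?_
  rintro q ⟨hq1, hq2⟩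
  apply hz
  by_contra h
  exact hq2 ⟨hq1.1, by simpa using not_lt.1 h⟩

lemma slice_fst {G : R3 × R3 → ℝ} {x v : R3} (hG : DifferentiableAt ℝ G (x, v)) (u : R3) :
    fderiv ℝ (fun y => G (y, v)) x u = fderiv ℝ G (x, v) (u, 0) := by
  have h2 : HasFDerivAt (fun y => G (y, v)) _ x :=
    HasFDerivAt.comp (g := G) (f := fun y => (y, v)) x hG.hasFDerivAt
      (hasFDerivAt_prodMk_left (𝕜 := ℝ) x v)
  rw [h2.fderiv]; simp

lemma slice_snd {G : R3 × R3 → ℝ} {x v : R3} (hG : DifferentiableAt ℝ G (x, v)) (u : R3) :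
    fderiv ℝ (fun w => G (x, w)) v u = fderiv ℝ G (x, v) (0, u) := by
  have := hG.hasFDerivAt.comp v (hasFDerivAt_prodMk_right x v)
  have h2 : HasFDerivAt (fun w => G (x, w)) _ v := this
  rw [h2.fderiv]; simp

lemma DopS_eq (E0 B0 : R3 → R3) (g : R3 → R3 → ℝ) (x v : R3)
    (hG : DifferentiableAt ℝ (fun q : R3 × R3 => g q.1 q.2) (x, v)) :
    DopS 1 E0 B0 g x v =
      fderiv ℝ (fun q : R3 × R3 => g q.1 q.2) (x, v) (vhat v, Wf (E0 x) (B0 x) v) := by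
  have h1 := fun u => slice_fst hG u
  have h2 := fun u => slice_snd hG u
  simp only at h1 h2
  have e : ((vhat v, Wf (E0 x) (B0 x) v) : R3 × R3) = (vhat v, 0) + (0, Wf (E0 x) (B0 x) v) := by
    simp
  rw [e, map_add, ← h1, ← h2, clm_expand, clm_expand (fderiv ℝ (fun w => g x w) v)]
  simp only [DopS, dot, grad, pd, one_mul, Wf]

lemma bint (Q : (Fin 2 → ℝ) × R3 → ℝ) (hQ : Continuous Q) (R : ℝ)
    (hz : ∀ q : (Fin 2 → ℝ) × R3, R ≤ ‖q.2‖ → Q q = 0) :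
    Integrable Q ((volume.restrict (Icc (fun _ => -π : Fin 2 → ℝ) (fun _ => π))).prod volume) := by
  set I := Icc (fun _ => -π : Fin 2 → ℝ) (fun _ => π)
  have hμ : (volume.restrict I).prod (volume : Measure R3) =
      ((volume : Measure (Fin 2 → ℝ)).prod (volume : Measure R3)).restrict (I ×ˢ univ) := by
    rw [← Measure.prod_restrict, Measure.restrict_univ]
  rw [hμ]
  have hK : IsCompact (I ×ˢ (Metric.closedBall 0 R : Set R3)) :=
    isCompact_Icc.prod (isCompact_closedBall _ _)
  refine IntegrableOn.of_forall_sdiff_eq_zero (hQ.continuousOn.integrableOn_compact hK)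
    (measurableSet_Icc.prod MeasurableSet.univ) ?_
  rintro q ⟨hq1, hq2⟩
  apply hz
  by_contra h
  exact hq2 ⟨hq1.1, by simpa using (not_le.1 h).le⟩

lemma phS_slice_v (a : ℝ) {f : R3 × R3 → ℝ} (hf : ContDiffOn ℝ 1 f (phS a)) (x : R3)
    (hx : x ∈ closure (torus a)) : ContDiff ℝ 1 (fun v => f (x, v)) := by
  rw [← contDiffOn_univ]
  exact hf.comp (ContDiff.contDiffOn (by fun_prop)) fun v _ => ⟨hx, mem_univ _⟩

lemma phS_slice_x (a : ℝ) {f : R3 × R3 → ℝ} (hf : ContDiffOn ℝ 1 f (phS a)) (v : R3) :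
    ContDiffOn ℝ 1 (fun x => f (x, v)) (closure (torus a)) :=
  hf.comp (ContDiff.contDiffOn (by fun_prop)) fun x hx => ⟨hx, mem_univ _⟩

lemma phS_bX (a : ℝ) (ha : 1 < a) {f : R3 × R3 → ℝ} (hf : ContinuousOn f (phS a)) :
    Continuous (fun q : (Fin 2 → ℝ) × R3 => f (bX a q.1, q.2)) := by
  have := bX_cont a
  exact hf.comp_continuous (by fun_prop) fun q => ⟨bX_mem_closure a ha q.1, mem_univ _⟩

lemma dot_cont : Continuous (fun q : R3 × R3 => dot q.1 q.2) := by
  unfold dot; fun_prop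

lemma main_id (a : ℝ) (ha : 1 < a) (E0 B0 : R3 → R3)
    (hE0c : ContinuousOn E0 (closure (torus a)))
    (hB0c : ContinuousOn B0 (closure (torus a)))
    (g h : R3 → R3 → ℝ)
    (hg : ContDiffOn ℝ 1 (fun q : R3 × R3 => g q.1 q.2) (phS a))
    (hh : ContDiffOn ℝ 1 (fun q : R3 × R3 => h q.1 q.2) (phS a))
    (R : ℝ) (hR : ∀ x v : R3, R ≤ ‖v‖ → h x v = 0) :
    (∫ x in torus a, ∫ v : R3, g x v * DopS 1 E0 B0 h x v) +
      (∫ x in torus a, ∫ v : R3, DopS 1 E0 B0 g x v * h x v) =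
    ∫ y in Icc (fun _ => -π : Fin 2 → ℝ) (fun _ => π), ∫ v : R3,
      (a + Real.cos (y 0)) * dot (vhat v) (bn y) * (g (bX a y) v * h (bX a y) v) := by
  set G : R3 × R3 → ℝ := fun q => g q.1 q.2 with hG
  set H : R3 × R3 → ℝ := fun q => h q.1 q.2 with hH
  set K : R3 × R3 → ℝ := fun q => G q * H q with hK
  have hKc : ContDiffOn ℝ 1 K (phS a) := hg.mul hh
  set Z1 : R3 × R3 → R3 × R3 := fun q => (vhat q.2, 0) with hZ1
  set Z2 : R3 × R3 → R3 × R3 := fun q => (0, Wf (E0 q.1) (B0 q.1) q.2) with hZ2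
  set Z : R3 × R3 → R3 × R3 := fun q => (vhat q.2, Wf (E0 q.1) (B0 q.1) q.2) with hZ
  have hvc : ContinuousOn (fun q : R3 × R3 => vhat q.2) (phS a) :=
    (vhat_cont.comp continuous_snd).continuousOn
  have hWc : ContinuousOn (fun q : R3 × R3 => Wf (E0 q.1) (B0 q.1) q.2) (phS a) := by
    have hE : ContinuousOn (fun q : R3 × R3 => E0 q.1) (phS a) :=
      hE0c.comp continuousOn_fst fun q hq => hq.1
    have hB : ContinuousOn (fun q : R3 × R3 => B0 q.1) (phS a) :=
      hB0c.comp continuousOn_fst fun q hq => hq.1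
    rw [continuousOn_pi] at hE hB hvc ⊢
    intro i
    have e0 := hE 0
    have e1 := hE 1
    have e2 := hE 2
    have b0 := hB 0
    have b1 := hB 1
    have b2 := hB 2
    have v0 := hvc 0
    have v1 := hvc 1
    have v2 := hvc 2
    fin_cases i
    · exact e0.add ((v1.mul b2).sub (v2.mul b1))
    · exact e1.add ((v2.mul b0).sub (v0.mul b2))
    · exact e2.add ((v0.mul b1).sub (v1.mul b0))
  have hZ1c : ContinuousOn Z1 (phS a) := hvc.prodMk continuousOn_const
  have hZ2c : ContinuousOn Z2 (phS a) := continuousOn_const.prodMk hWc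
  have hZc : ContinuousOn Z (phS a) := hvc.prodMk hWc
  have hopen : IsOpen {q : R3 × R3 | R < ‖q.2‖} := isOpen_lt (by fun_prop) (by fun_prop)
  have hfz : ∀ q : R3 × R3, R < ‖q.2‖ → fderiv ℝ H q = 0 := by
    intro q hq
    have : H =ᶠ[𝓝 q] fun _ => 0 := by
      filter_upwards [hopen.mem_nhds hq] with p hp
      exact hR _ _ (le_of_lt hp)
    rw [this.fderiv_eq]; simp
  have hfzK : ∀ q : R3 × R3, R < ‖q.2‖ → fderiv ℝ K q = 0 := by
    intro q hq
    have : K =ᶠ[𝓝 q] fun _ => 0 := by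
      filter_upwards [hopen.mem_nhds hq] with p hp
      simp only [hK, hH]
      rw [hR _ _ (le_of_lt hp), mul_zero]
    rw [this.fderiv_eq]; simp
  have i1 := int_lemma a ha H G Z hh hg.continuousOn hZc R
    (fun q hq => by rw [hfz q hq]; simp)
  have i2 := int_lemma a ha G H Z hg hh.continuousOn hZc R
    (fun q hq => by simp only [hH]; rw [hR _ _ hq.le]; simp)
  have i3 := int_lemma a ha K (fun _ => 1) Z1 hKc continuousOn_const hZ1c R
    (fun q hq => by rw [hfzK q hq]; simp)
  have i4 := int_lemma a ha K (fun _ => 1) Z2 hKc continuousOn_const hZ2c R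
    (fun q hq => by rw [hfzK q hq]; simp)
  have hTm := (torus_open a).measurableSet
  have l1 : (∫ x in torus a, ∫ v : R3, g x v * DopS 1 E0 B0 h x v) =
      ∫ q, G q * fderiv ℝ H q (Z q) ∂((volume.restrict (torus a)).prod volume) := by
    rw [integral_prod _ i1]
    refine setIntegral_congr_fun hTm fun x hx => ?_
    refine integral_congr_ae (Eventually.of_forall fun v => ?_)
    simp only
    rw [DopS_eq E0 B0 h x v (phS_diff a hh hx)]
  have l2 : (∫ x in torus a, ∫ v : R3, DopS 1 E0 B0 g x v * h x v) =
      ∫ q, H q * fderiv ℝ G q (Z q) ∂((volume.restrict (torus a)).prod volume) := by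
    rw [integral_prod _ i2]
    refine setIntegral_congr_fun hTm fun x hx => ?_
    refine integral_congr_ae (Eventually.of_forall fun v => ?_)
    simp only
    rw [DopS_eq E0 B0 g x v (phS_diff a hg hx), mul_comm]
  have l3 : ∫ q, (fun _ => (1:ℝ)) q * fderiv ℝ K q (Z2 q)
      ∂((volume.restrict (torus a)).prod volume) = 0 := by
    rw [integral_prod _ i4]
    have : ∀ x ∈ torus a, (∫ v, (1:ℝ) * fderiv ℝ K (x, v) (Z2 (x, v))) = 0 := by
      intro x hx
      rw [← v_part (E0 x) (B0 x) (fun v => K (x, v)) (phS_slice_v a hKc x (subset_closure hx)) ?_]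
      · refine integral_congr_ae (Eventually.of_forall fun v => ?_)
        simp only
        rw [slice_snd (phS_diff a hKc hx), one_mul]
      · refine HasCompactSupport.intro (isCompact_closedBall (0 : R3) R) fun v hv => ?_
        simp only [hK, hH]
        rw [hR _ _ (by simpa using (not_le.1 (fun h => hv (by simpa using h))).le), mul_zero]
    rw [setIntegral_congr_fun hTm this]
    simp
  have l4 : ∫ q, (fun _ => (1:ℝ)) q * fderiv ℝ K q (Z1 q)
      ∂((volume.restrict (torus a)).prod volume) =
      ∫ v : R3, ∫ y in Icc (fun _ => -π : Fin 2 → ℝ) (fun _ => π),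
      (a + Real.cos (y 0)) * dot (vhat v) (bn y) * (g (bX a y) v * h (bX a y) v) := by
    rw [integral_prod_symm _ i3]
    refine integral_congr_ae (Eventually.of_forall fun v => ?_)
    have := div_torus a ha (fun x => K (x, v)) (phS_slice_x a hKc v) (vhat v)
    refine Eq.trans ?_ this
    refine setIntegral_congr_fun hTm fun x hx => ?_
    rw [slice_fst (phS_diff a hKc hx), one_mul]
  rw [l1, l2, ← integral_add i1 i2]
  have l5 : ∫ q, G q * fderiv ℝ H q (Z q) + H q * fderiv ℝ G q (Z q)
      ∂((volume.restrict (torus a)).prod volume) =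
      ∫ q, ((fun _ => (1:ℝ)) q * fderiv ℝ K q (Z1 q) + (fun _ => (1:ℝ)) q * fderiv ℝ K q (Z2 q))
      ∂((volume.restrict (torus a)).prod volume) := by
    have hμ : (volume.restrict (torus a)).prod (volume : Measure R3) =
        ((volume : Measure R3).prod (volume : Measure R3)).restrict (torus a ×ˢ univ) := by
      rw [← Measure.prod_restrict, Measure.restrict_univ]
    rw [hμ]
    refine setIntegral_congr_fun (torus_prod_open a).measurableSet fun q hq => ?_
    have hd := ((phS_diff a hg hq.1).hasFDerivAt.mul (phS_diff a hh hq.1).hasFDerivAt)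
    have hd' : HasFDerivAt K _ q := hd
    simp only [one_mul]
    rw [← map_add, hd'.fderiv]
    simp [hZ, hZ1, hZ2]
  rw [l5, integral_add i3 i4, l3, add_zero, l4]
  have hgc := phS_bX a ha hg.continuousOn
  have hhc := phS_bX a ha hh.continuousOn
  have hdc : Continuous (fun q : (Fin 2 → ℝ) × R3 => dot (vhat q.2) (bn q.1)) := by
    have h1 := vhat_cont
    have h2 := bn_cont
    exact dot_cont.comp (f := fun q : (Fin 2 → ℝ) × R3 => (vhat q.2, bn q.1)) (by fun_prop)
  have hQ := bint (fun q => (a + Real.cos (q.1 0)) * dot (vhat q.2) (bn q.1) *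
    (g (bX a q.1) q.2 * h (bX a q.1) q.2)) 
    (((by fun_prop : Continuous fun q : (Fin 2 → ℝ) × R3 => a + Real.cos (q.1 0)).mul hdc).mul
      (hgc.mul hhc)) R (fun q hq => by rw [hR _ _ hq]; simp)
  exact (integral_integral_swap hQ).symm

lemma norm_le_sqrt_nsq (v : R3) : ‖v‖ ≤ Real.sqrt (nsq v) := by
  rw [pi_norm_le_iff_of_nonneg (Real.sqrt_nonneg _)]
  intro i
  rw [Real.norm_eq_abs]
  apply Real.abs_le_sqrt
  exact Finset.single_le_sum (f := fun i => v i ^ 2) (fun _ _ => sq_nonneg _) (Finset.mem_univ i)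

lemma dot_vhat (v n : R3) : dot (vhat v) n = dot v n / vb v := by
  simp [dot, vhat, Fin.sum_univ_three]; ring

lemma vb_refl (n : R3) (hn : dot n n = 1) (v : R3) : vb (reflL n v) = vb v := by
  unfold vb; rw [reflL_nsq n hn]

lemma specRefl_eq (a : ℝ) (x v : R3) : specRefl a x v = reflL (nvec a x) v := rfl

lemma specular_bX {a : ℝ} (ha : 1 < a) {g : R3 → R3 → ℝ} (hs : specular a g) (y : Fin 2 → ℝ)
    (v : R3) : g (bX a y) (reflL (bn y) v) = g (bX a y) v := by
  rw [← nvec_bX a ha y, ← specRefl_eq]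
  exact (hs _ (bX_mem_frontier a ha y) v).symm

lemma inner_zero {a : ℝ} (ha : 1 < a) {g h : R3 → R3 → ℝ} (hg : specular a g) (hh : specular a h)
    (y : Fin 2 → ℝ) :
    ∫ v : R3, (a + Real.cos (y 0)) * dot (vhat v) (bn y) * (g (bX a y) v * h (bX a y) v) = 0 := by
  have h1 := reflL_integral (bn y) (bn_unit y) (fun v => (a + Real.cos (y 0)) *
    dot (vhat v) (bn y) * (g (bX a y) v * h (bX a y) v))
  have h2 : ∀ v, (a + Real.cos (y 0)) * dot (vhat (reflL (bn y) v)) (bn y) *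
      (g (bX a y) (reflL (bn y) v) * h (bX a y) (reflL (bn y) v)) =
      -((a + Real.cos (y 0)) * dot (vhat v) (bn y) * (g (bX a y) v * h (bX a y) v)) := by
    intro v
    rw [dot_vhat, dot_vhat, reflL_dot _ (bn_unit y), vb_refl _ (bn_unit y), specular_bX ha hg,
      specular_bX ha hh]
    ring
  simp only [h2, integral_neg] at h1
  linarith

/-- the test function -/
def tst (a : ℝ) (g : R3 → R3 → ℝ) (M : ℝ) (x v : R3) : ℝ :=
  dot v (nvec a x) * (g x v - g x (specRefl a x v)) * Real.smoothTransition (M - nsq v)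

lemma rad_rot (β : ℝ) (x : R3) : rad (rotZ β x) = rad x := by
  unfold rad
  congr 1
  simp [rotZ]
  linear_combination (x 0 ^ 2 + x 1 ^ 2) * Real.sin_sq_add_cos_sq β

lemma nvec_rot (a β : ℝ) (x : R3) : nvec a (rotZ β x) = rotZ β (nvec a x) := by
  unfold nvec
  rw [rad_rot]
  ext i
  fin_cases i <;> simp [rotZ] <;> ring

lemma dot_rot (β : ℝ) (u v : R3) : dot (rotZ β u) (rotZ β v) = dot u v := by
  simp [dot, rotZ, Fin.sum_univ_three]
  linear_combination (u 0 * v 0 + u 1 * v 1) * Real.sin_sq_add_cos_sq β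

lemma nsq_rot (β : ℝ) (v : R3) : nsq (rotZ β v) = nsq v := by
  simp [nsq, rotZ, Fin.sum_univ_three]
  linear_combination (v 0 ^ 2 + v 1 ^ 2) * Real.sin_sq_add_cos_sq β

lemma specRefl_rot (a β : ℝ) (x v : R3) :
    specRefl a (rotZ β x) (rotZ β v) = rotZ β (specRefl a x v) := by
  unfold specRefl
  rw [nvec_rot, dot_rot]
  ext i
  fin_cases i <;> simp [rotZ] <;> ring

lemma tst_torSym (a : ℝ) (g : R3 → R3 → ℝ) (M : ℝ) (hg : torSym2 g) : torSym2 (tst a g M) := by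
  intro β x v
  unfold tst
  rw [nvec_rot, dot_rot, nsq_rot, specRefl_rot, hg, hg]

lemma rad_contDiffOn (a : ℝ) (ha : 1 < a) : ContDiffOn ℝ 1 rad (closure (torus a)) := by
  unfold rad
  refine ContDiffOn.sqrt (ContDiff.contDiffOn (by fun_prop)) ?_
  intro x hx h0
  have := rad_pos_of_closure a ha hx
  unfold rad at this
  rw [h0] at this
  simp at this

lemma nvec_contDiffOn (a : ℝ) (ha : 1 < a) : ContDiffOn ℝ 1 (nvec a) (closure (torus a)) := by
  have hr := rad_contDiffOn a ha
  have hne : ∀ x ∈ closure (torus a), rad x ≠ 0 := fun x hx => (rad_pos_of_closure a ha hx).ne'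
  have hx : ∀ i, ContDiffOn ℝ 1 (fun x : R3 => x i) (closure (torus a)) := fun i =>
    ContDiff.contDiffOn (by fun_prop)
  rw [contDiffOn_pi]
  intro i
  fin_cases i
  · exact ((hr.sub contDiffOn_const).mul (hx 0)).div hr hne
  · exact ((hr.sub contDiffOn_const).mul (hx 1)).div hr hne
  · exact hx 2

lemma tst_contDiffOn (a : ℝ) (ha : 1 < a) (g : R3 → R3 → ℝ) (M : ℝ)
    (hg : ContDiffOn ℝ 1 (fun q : R3 × R3 => g q.1 q.2) (phS a)) :
    ContDiffOn ℝ 1 (fun q : R3 × R3 => tst a g M q.1 q.2) (phS a) := by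
  have hn : ContDiffOn ℝ 1 (fun q : R3 × R3 => nvec a q.1) (phS a) :=
    (nvec_contDiffOn a ha).comp contDiffOn_fst fun q hq => hq.1
  have hv : ContDiffOn ℝ 1 (fun q : R3 × R3 => q.2) (phS a) := contDiffOn_snd
  have hn' := contDiffOn_pi.1 hn
  have hv' := contDiffOn_pi.1 hv
  have hd : ContDiffOn ℝ 1 (fun q : R3 × R3 => dot q.2 (nvec a q.1)) (phS a) := by
    unfold dot
    exact ContDiffOn.sum fun i _ => (hv' i).mul (hn' i)
  have hs : ContDiffOn ℝ 1 (fun q : R3 × R3 => specRefl a q.1 q.2) (phS a) := by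
    rw [contDiffOn_pi]
    intro i
    exact (hv' i).sub ((contDiffOn_const.mul hd).mul (hn' i))
  have hgs : ContDiffOn ℝ 1 (fun q : R3 × R3 => g q.1 (specRefl a q.1 q.2)) (phS a) :=
    hg.comp (contDiffOn_fst.prodMk hs) fun q hq => ⟨hq.1, mem_univ _⟩
  have hχ : ContDiff ℝ 1 (fun q : R3 × R3 => Real.smoothTransition (M - nsq q.2)) := by
    have h1 : ContDiff ℝ 1 Real.smoothTransition := Real.smoothTransition.contDiff
    have h2 := nsq_contDiff
    exact h1.comp (contDiff_const.sub (h2.comp contDiff_snd))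
  exact (hd.mul (hg.sub hgs)).mul hχ.contDiffOn

lemma tst_refl (a : ℝ) (ha : 1 < a) (g : R3 → R3 → ℝ) (M : ℝ) (y : Fin 2 → ℝ) (v : R3) :
    tst a g M (bX a y) (reflL (bn y) v) = tst a g M (bX a y) v := by
  unfold tst
  rw [specRefl_eq, specRefl_eq, nvec_bX a ha, reflL_dot _ (bn_unit y), reflL_nsq _ (bn_unit y),
    reflL_invol _ (bn_unit y)]
  ring

lemma tst_specular (a : ℝ) (ha : 1 < a) (g : R3 → R3 → ℝ) (M : ℝ) : specular a (tst a g M) := by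
  intro x hx v
  obtain ⟨y, -, rfl⟩ := bX_surj a hx
  rw [specRefl_eq, nvec_bX a ha, tst_refl a ha]

lemma tst_supp (a : ℝ) (g : R3 → R3 → ℝ) (M : ℝ) (x v : R3) (h : M ≤ nsq v) :
    tst a g M x v = 0 := by
  unfold tst
  rw [Real.smoothTransition.zero_of_nonpos (by linarith), mul_zero]

lemma tst_supp' (a : ℝ) (g : R3 → R3 → ℝ) (M : ℝ) (x v : R3) (h : Real.sqrt M ≤ ‖v‖) :
    tst a g M x v = 0 := by
  apply tst_supp
  have := h.trans (norm_le_sqrt_nsq v)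
  exact (Real.sqrt_le_sqrt_iff (nsq_nonneg v)).1 this

lemma Icc_sub_closure : (Icc (fun _ => -π : Fin 2 → ℝ) (fun _ => π)) ×ˢ (univ : Set R3) ⊆
    closure (interior ((Icc (fun _ => -π : Fin 2 → ℝ) (fun _ => π)) ×ˢ (univ : Set R3))) := by
  have hpi := Real.pi_pos
  rw [interior_prod_eq, closure_prod_eq, ← pi_univ_Icc, interior_pi_set finite_univ, closure_pi_set]
  simp only [interior_univ, closure_univ, interior_Icc]
  rw [closure_Ioo (by linarith)]

lemma reverse_dir (a : ℝ) (ha : 1 < a) (g : R3 → R3 → ℝ)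
    (hg : ContDiffOn ℝ 1 (fun q : R3 × R3 => g q.1 q.2) (phS a)) (M : ℝ)
    (h0 : ∫ y in Icc (fun _ => -π : Fin 2 → ℝ) (fun _ => π), ∫ v : R3,
      (a + Real.cos (y 0)) * dot (vhat v) (bn y) * (g (bX a y) v * tst a g M (bX a y) v) = 0)
    (y : Fin 2 → ℝ) (hy : y ∈ Icc (fun _ => -π : Fin 2 → ℝ) (fun _ => π)) (v : R3)
    (hM : nsq v < M) : g (bX a y) v = g (bX a y) (reflL (bn y) v) := by
  have hdc : Continuous (fun q : (Fin 2 → ℝ) × R3 => dot (vhat q.2) (bn q.1)) := by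
    have h1 := vhat_cont
    have h2 := bn_cont
    exact dot_cont.comp (f := fun q : (Fin 2 → ℝ) × R3 => (vhat q.2, bn q.1)) (by fun_prop)
  have hdc' : Continuous (fun q : (Fin 2 → ℝ) × R3 => dot q.2 (bn q.1)) := by
    have h2 := bn_cont
    exact dot_cont.comp (f := fun q : (Fin 2 → ℝ) × R3 => (q.2, bn q.1)) (by fun_prop)
  have hgc : Continuous (fun q : (Fin 2 → ℝ) × R3 => g (bX a q.1) q.2) :=
    phS_bX a ha hg.continuousOn
  have hhc : Continuous (fun q : (Fin 2 → ℝ) × R3 => tst a g M (bX a q.1) q.2) :=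
    phS_bX a ha (tst_contDiffOn a ha g M hg).continuousOn
  have hrc : Continuous (fun q : (Fin 2 → ℝ) × R3 => reflL (bn q.1) q.2) := by
    have h2 := continuous_pi_iff.1 bn_cont
    rw [continuous_pi_iff]
    intro i
    change Continuous (fun q : (Fin 2 → ℝ) × R3 => q.2 i - 2 * dot q.2 (bn q.1) * bn q.1 i)
    fun_prop
  have hgrc : Continuous (fun q : (Fin 2 → ℝ) × R3 => g (bX a q.1) (reflL (bn q.1) q.2)) :=
    hgc.comp (f := fun q : (Fin 2 → ℝ) × R3 => (q.1, reflL (bn q.1) q.2)) (by fun_prop)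
  have hac : Continuous fun q : (Fin 2 → ℝ) × R3 => a + Real.cos (q.1 0) := by fun_prop
  set A : (Fin 2 → ℝ) × R3 → ℝ := fun q => (a + Real.cos (q.1 0)) * dot (vhat q.2) (bn q.1) *
    (g (bX a q.1) q.2 * tst a g M (bX a q.1) q.2) with hA
  set B : (Fin 2 → ℝ) × R3 → ℝ := fun q => -((a + Real.cos (q.1 0)) * dot (vhat q.2) (bn q.1) *
    (g (bX a q.1) (reflL (bn q.1) q.2) * tst a g M (bX a q.1) q.2)) with hB
  have hAc : Continuous A := (hac.mul hdc).mul (hgc.mul hhc)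
  have hBc : Continuous B := ((hac.mul hdc).mul (hgrc.mul hhc)).neg
  have hAz : ∀ q : (Fin 2 → ℝ) × R3, Real.sqrt M ≤ ‖q.2‖ → A q = 0 := by
    intro q hq; simp only [hA]; rw [tst_supp' a g M _ _ hq]; simp
  have hBz : ∀ q : (Fin 2 → ℝ) × R3, Real.sqrt M ≤ ‖q.2‖ → B q = 0 := by
    intro q hq; simp only [hB]; rw [tst_supp' a g M _ _ hq]; simp
  have hAI := bint A hAc _ hAz
  have hBI := bint B hBc _ hBz
  have hBA : ∀ y v, B (y, v) = A (y, reflL (bn y) v) := by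
    intro y v
    simp only [hA, hB]
    rw [dot_vhat, dot_vhat, reflL_dot _ (bn_unit y), vb_refl _ (bn_unit y), tst_refl a ha]
    ring
  have hAint : ∫ q, A q ∂((volume.restrict (Icc (fun _ => -π : Fin 2 → ℝ) (fun _ => π))).prod
      volume) = 0 := by
    rw [integral_prod _ hAI]; exact h0
  have hBint : ∫ q, B q ∂((volume.restrict (Icc (fun _ => -π : Fin 2 → ℝ) (fun _ => π))).prod
      volume) = 0 := by
    rw [integral_prod _ hBI]
    simp only [hBA]
    have : ∀ y : Fin 2 → ℝ, ∫ v, A (y, reflL (bn y) v) = ∫ v, A (y, v) := fun y =>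
      reflL_integral (bn y) (bn_unit y) (fun v => A (y, v))
    simp only [this]
    exact h0
  have hAB : ∀ q, A q + B q = (a + Real.cos (q.1 0)) * (dot q.2 (bn q.1) ^ 2 / vb q.2) *
      (g (bX a q.1) q.2 - g (bX a q.1) (reflL (bn q.1) q.2)) ^ 2 *
      Real.smoothTransition (M - nsq q.2) := by
    intro q
    simp only [hA, hB, tst]
    rw [dot_vhat, specRefl_eq, nvec_bX a ha]
    ring
  have hcpos : ∀ t : ℝ, 0 < a + Real.cos t := fun t => by linarith [Real.neg_one_le_cos t]
  have hnn : ∀ q, 0 ≤ A q + B q := by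
    intro q
    rw [hAB]
    have := (hcpos (q.1 0)).le
    have h2 := (vb_pos q.2).le
    have h3 := Real.smoothTransition.nonneg (M - nsq q.2)
    positivity
  have hsum : ∫ q, (A q + B q) ∂((volume.restrict (Icc (fun _ => -π : Fin 2 → ℝ)
      (fun _ => π))).prod volume) = 0 := by
    rw [integral_add hAI hBI, hAint, hBint, add_zero]
  rw [integral_eq_zero_iff_of_nonneg hnn (hAI.add hBI)] at hsum
  have hμ : (volume.restrict (Icc (fun _ => -π : Fin 2 → ℝ) (fun _ => π))).prod
      (volume : Measure R3) = ((volume : Measure (Fin 2 → ℝ)).prod (volume : Measure R3)).restrict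
        ((Icc (fun _ => -π : Fin 2 → ℝ) (fun _ => π)) ×ˢ univ) := by
    rw [← Measure.prod_restrict, Measure.restrict_univ]
  rw [hμ] at hsum
  have heq := Measure.eqOn_of_ae_eq hsum (hAc.add hBc).continuousOn continuousOn_const
    Icc_sub_closure
  have hq := heq (show (y, v) ∈ _ from ⟨hy, mem_univ _⟩)
  simp only [hAB, Pi.zero_apply] at hq
  have h3 := Real.smoothTransition.pos_of_pos (x := M - nsq v) (by linarith)
  have h1 := (hcpos (y 0)).ne'
  have h2 := (vb_pos v).ne'
  have h4 : dot v (bn y) = 0 ∨ g (bX a y) v - g (bX a y) (reflL (bn y) v) = 0 := by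
    simpa [h1, h2, h3.ne'] using hq
  rcases h4 with h4 | h4
  · have : reflL (bn y) v = v := by
      ext i
      change v i - 2 * dot v (bn y) * bn y i = v i
      rw [h4]; ring
    rw [this]
  · linarith


/-- Lemma 2.1. A toroidally symmetric `g ∈ C¹(Ω̄ × ℝ³)` is specular on
`∂Ω` iff the transport operator `D` is skew-symmetric against every toroidally symmetric
`C¹` test function `h` with compact support in `v` that is specular on `∂Ω`. -/
theorem stmt0 (a : ℝ) (ha : 1 < a) (E0 B0 : R3 → R3)
    (hE0c : ContinuousOn E0 (closure (torus a)))
    (hB0c : ContinuousOn B0 (closure (torus a)))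
    (hE0s : torSymV E0) (hB0s : torSymV B0)
    (g : R3 → R3 → ℝ)
    (hg : ContDiffOn ℝ 1 (fun q : R3 × R3 => g q.1 q.2)
      ((closure (torus a)) ×ˢ (univ : Set R3)))
    (hgs : torSym2 g) :
    specular a g ↔
      ∀ h : R3 → R3 → ℝ,
        ContDiffOn ℝ 1 (fun q : R3 × R3 => h q.1 q.2)
          ((closure (torus a)) ×ˢ (univ : Set R3)) →
        torSym2 h →
        (∃ R : ℝ, ∀ x v : R3, R ≤ Real.sqrt (nsq v) → h x v = 0) →
        specular a h →
        ∫ x in torus a, ∫ v : R3, g x v * DopS 1 E0 B0 h x v =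
          -∫ x in torus a, ∫ v : R3, DopS 1 E0 B0 g x v * h x v := by
  have hmain := main_id a ha E0 B0 hE0c hB0c g
  constructor
  · rintro hsg h hh hhs ⟨R, hR⟩ hsh
    have h1 := hmain h hg hh R fun x v hv => hR x v (hv.trans (norm_le_sqrt_nsq v))
    simp only [inner_zero ha hsg hsh, integral_zero] at h1
    linarith
  · intro H x hx v
    obtain ⟨y, hy, rfl⟩ := bX_surj a hx
    rw [specRefl_eq, nvec_bX a ha]
    have hc := tst_contDiffOn a ha g (nsq v + 1) hg
    have h1 := hmain (tst a g (nsq v + 1)) hg hc _ (tst_supp' a g (nsq v + 1))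
    have h2 := H (tst a g (nsq v + 1)) hc (tst_torSym a g _ hgs)
      ⟨Real.sqrt (nsq v + 1), fun x w hw => tst_supp a g _ x w
        ((Real.sqrt_le_sqrt_iff (nsq_nonneg w)).1 hw)⟩ (tst_specular a ha g _)
    rw [h2, neg_add_cancel] at h1
    exact reverse_dir a ha g hg (nsq v + 1) h1.symm y hy v (by linarith)


end
end

section
/- Consider the homogeneous case φ⁰ = A_φ⁰ = 0, so e(x,v) = ⟨v⟩ and p(x,v) = ρ(x) v_φ. Let w : (1,∞) × ℝ → [0,∞) be measurable with w(e,p) ≤ C/(1+e^γ) for some C and some γ > 3, and let ν be the measure w(e(x,v), p(x,v)) dv dx on Ω × ℝ³. Let h : Ω → ℝ be bounded, measurable and toroidally symmetric, and write h̃(r,θ) for h in toroidal coordinates. For e > 1 and |p| < (a+1)√(e²−1) set I_{e,p} = {(r,θ) ∈ (0,1) × [0,2π) : a + r cos θ > |p|/√(e²−1)}, and define g(e,p) = ( ∫_{I_{e,p}} h̃(r,θ) r dr dθ ) / ( ∫_{I_{e,p}} r dr dθ ) (and g(e,p) = 0 otherwise). Then for every bounded measurable ξ : ℝ² → ℝ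 one has ∫_{Ω×ℝ³} ξ(e(x,v), p(x,v)) · [ h(x) − g(e(x,v), p(x,v)) ] dν = 0; equivalently, the orthogonal projection of h in L²(ν) onto the closed subspace of functions of the form G(e(x,v), p(x,v)) equals g(e(x,v), p(x,v)). -/
open MeasureTheory Real Set Filter
open scoped ENNReal NNReal

noncomputable section

/-- The cross-section region `I_{e,p} ⊆ (0,1) × [0,2π)` determined by `a + r cos θ > |p|/√(e²−1)`. -/
def Iep (a e p : ℝ) : Set (ℝ × ℝ) :=
  {q | 0 < q.1 ∧ q.1 < 1 ∧ 0 ≤ q.2 ∧ q.2 < 2 * π ∧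
    |p| / Real.sqrt (e ^ 2 - 1) < a + q.1 * Real.cos q.2}

/-- The point of `Ω` with toroidal coordinates `(r, θ)` and `φ = 0`. -/
def torusPt (a r θ : ℝ) : R3 := ![a + r * Real.cos θ, 0, r * Real.sin θ]

/-- The average value `g(e,p)` of `h` (in toroidal coordinates, weighted by `r dr dθ`)
over `I_{e,p}`, for `e > 1` and `|p| < (a+1)√(e²−1)`; `0` otherwise. -/
def projg (a : ℝ) (h : R3 → ℝ) (e p : ℝ) : ℝ :=
  if 1 < e ∧ |p| < (a + 1) * Real.sqrt (e ^ 2 - 1) then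
    (∫ q in Iep a e p, h (torusPt a q.1 q.2) * q.1) / (∫ q in Iep a e p, q.1)
  else 0

lemma lint_R3 (F : R3 → ℝ≥0∞) (hF : Measurable F) :
    ∫⁻ x, F x = ∫⁻ z : ℝ, ∫⁻ y : ℝ × ℝ, F ![y.1, y.2, z] := by
  have h1 := (volume_preserving_piFinSuccAbove (fun _ : Fin 3 => ℝ) 2).symm
  have h2 := (volume_preserving_finTwoArrow ℝ).symm
  rw [← h1.lintegral_comp hF, Measure.volume_eq_prod, lintegral_prod _ (by fun_prop)]
  congr 1; ext z
  rw [← h2.lintegral_comp (f := fun b => F ((MeasurableEquiv.piFinSuccAbove (fun _ : Fin 3 => ℝ) 2).symm (z, b))) (by fun_prop)]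
  congr 1; ext y
  congr 1
  ext i
  fin_cases i <;> rfl

lemma lint_radial (G : ℝ → ℝ≥0∞) (hG : Measurable G) :
    ∫⁻ y : ℝ × ℝ, G (Real.sqrt (y.1 ^ 2 + y.2 ^ 2)) =
      ENNReal.ofReal (2 * π) * ∫⁻ r in Ioi (0:ℝ), ENNReal.ofReal r * G r := by
  rw [← lintegral_comp_polarCoord_symm, polarCoord_target, Measure.volume_eq_prod,
    ← Measure.prod_restrict]
  have : ∀ᵐ q : ℝ × ℝ ∂((volume.restrict (Ioi (0:ℝ))).prod (volume.restrict (Ioo (-π) π))),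
      ENNReal.ofReal q.1 • G (Real.sqrt ((polarCoord.symm q).1 ^ 2 + (polarCoord.symm q).2 ^ 2))
        = (fun q : ℝ × ℝ => ENNReal.ofReal q.1 * G q.1) q := by
    rw [Measure.prod_restrict, ae_restrict_iff' (measurableSet_Ioi.prod measurableSet_Ioo)]
    refine Eventually.of_forall fun q hq => ?_
    have h0 : 0 < q.1 := hq.1
    simp only [polarCoord_symm_apply, smul_eq_mul]
    congr 2
    rw [show (q.1 * cos q.2) ^ 2 + (q.1 * sin q.2) ^ 2 = q.1 ^ 2 * (cos q.2 ^ 2 + sin q.2 ^ 2) by ring,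
      Real.cos_sq_add_sin_sq, mul_one, Real.sqrt_sq h0.le]
  rw [lintegral_congr_ae this, lintegral_prod _ (by fun_prop)]
  simp only [lintegral_const, Measure.restrict_apply_univ, Real.volume_Ioo]
  rw [lintegral_mul_const _ (by fun_prop), mul_comm]
  congr 2; ring

lemma lint_rot (x : R3) (hx : 0 < rad x) (G : ℝ × ℝ → ℝ≥0∞) (hG : Measurable G) :
    ∫⁻ v : R3, G (vb v, dot v (ephi x)) = ∫⁻ v : R3, G (vb v, v 2) := by
  have hr : (x 0 / rad x) ^ 2 + (x 1 / rad x) ^ 2 = 1 := by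
    have : rad x ^ 2 = (x 0) ^ 2 + (x 1) ^ 2 := Real.sq_sqrt (by positivity)
    field_simp; linarith
  set c := x 0 / rad x with hc
  set s := x 1 / rad x with hs
  let M : Matrix (Fin 3) (Fin 3) ℝ := !![c, s, 0; 0, 0, 1; -s, c, 0]
  have hdet : M.det = -1 := by
    simp [M, Matrix.det_fin_three]; linarith
  have hm := Real.map_matrix_volume_pi_eq_smul_volume_pi (M := M) (by rw [hdet]; norm_num)
  simp only [hdet] at hm
  norm_num at hm
  have hmeas : Measurable (fun v : R3 => G (vb v, v 2)) := by
    unfold vb nsq; fun_prop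
  conv_rhs => rw [← hm]
  rw [lintegral_map hmeas (LinearMap.continuous_of_finiteDimensional _).measurable]
  congr 1; ext v
  congr 2
  · unfold vb nsq
    congr 2
    simp [M, Fin.sum_univ_three, Matrix.mulVec, dotProduct]
    linear_combination (-(v 0)^2 - (v 1)^2) * hr
  · simp [M, dot, ephi, Fin.sum_univ_three, Matrix.mulVec, dotProduct, hc, hs]
    ring

lemma lint_energy (t : ℝ) (G : ℝ → ℝ≥0∞) :
    ∫⁻ s in Ioi (0:ℝ), ENNReal.ofReal s * G (Real.sqrt (1 + (s ^ 2 + t ^ 2))) =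
      ∫⁻ e in Ioi (Real.sqrt (1 + t ^ 2)), ENNReal.ofReal e * G e := by
  let f : ℝ → ℝ := fun s => Real.sqrt (1 + (s ^ 2 + t ^ 2))
  have himg : f '' Ioi 0 = Ioi (Real.sqrt (1 + t ^ 2)) := by
    ext e
    constructor
    · rintro ⟨s, hs, rfl⟩
      have : (0:ℝ) < s := hs
      exact Real.sqrt_lt_sqrt (by positivity) (by nlinarith)
    · intro he
      have he' : Real.sqrt (1 + t ^ 2) < e := he
      have he0 : 0 ≤ e := (Real.sqrt_nonneg _).trans he'.le
      have h2 := (Real.sqrt_lt (by positivity) he0).1 he'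
      refine ⟨Real.sqrt (e ^ 2 - (1 + t ^ 2)), Real.sqrt_pos.2 (by linarith), ?_⟩
      simp only [f]
      rw [Real.sq_sqrt (by linarith), show 1 + (e ^ 2 - (1 + t ^ 2) + t ^ 2) = e ^ 2 by ring,
        Real.sqrt_sq he0]
  have hinj : InjOn f (Ioi 0) := by
    intro s hs s' hs' h
    have hs0 : (0:ℝ) < s := hs
    have hs0' : (0:ℝ) < s' := hs'
    have := (Real.sqrt_inj (by positivity) (by positivity)).1 h
    exact (sq_eq_sq₀ hs0.le hs0'.le).1 (by linarith)
  have hder : ∀ s ∈ Ioi (0:ℝ), HasDerivWithinAt f (s / f s) (Ioi 0) s := by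
    intro s hs
    have : HasDerivAt (fun s : ℝ => 1 + (s ^ 2 + t ^ 2)) (2 * s) s := by
      simpa using ((hasDerivAt_pow 2 s).add_const (t ^ 2)).const_add 1
    have h3 := (this.sqrt (by positivity)).hasDerivWithinAt (s := Ioi 0)
    rw [mul_div_mul_left _ _ two_ne_zero] at h3
    exact h3
  rw [← himg, lintegral_image_eq_lintegral_abs_deriv_mul measurableSet_Ioi hder hinj]
  refine setLIntegral_congr_fun measurableSet_Ioi fun s hs => ?_
  have hs0 : (0:ℝ) < s := hs
  have hf : 0 < f s := Real.sqrt_pos.2 (by positivity)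
  show _ = _ * (_ * _)
  rw [← mul_assoc, ← ENNReal.ofReal_mul (abs_nonneg _), abs_of_pos (by positivity),
    div_mul_cancel₀ _ hf.ne']

lemma lint_vel (x : R3) (hx : 0 < rad x) (G : ℝ × ℝ → ℝ≥0∞) (hG : Measurable G) :
    ∫⁻ v : R3, G (vb v, dot v (ephi x)) = ∫⁻ t : ℝ, ENNReal.ofReal (2 * π) *
      ∫⁻ e in Ioi (Real.sqrt (1 + t ^ 2)), ENNReal.ofReal e * G (e, t) := by
  have hmeas : Measurable (fun v : R3 => G (vb v, v 2)) := by
    unfold vb nsq; fun_prop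
  rw [lint_rot x hx G hG, lint_R3 _ hmeas]
  congr 1; ext t
  rw [← lint_energy t (fun e => G (e, t)), ← lint_radial (fun s => G (Real.sqrt (1 + (s ^ 2 + t ^ 2)), t)) (by fun_prop)]
  congr 1; ext y
  have h1 : vb ![y.1, y.2, t] = Real.sqrt (1 + (Real.sqrt (y.1 ^ 2 + y.2 ^ 2) ^ 2 + t ^ 2)) := by
    rw [Real.sq_sqrt (by positivity)]
    simp [vb, nsq, Fin.sum_univ_three]
  rw [h1]
  simp

lemma lint_scale (ρ : ℝ) (hρ : 0 < ρ) (K : ℝ → ℝ≥0∞) (hK : Measurable K) :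
    ENNReal.ofReal ρ * ∫⁻ t, K t = ∫⁻ p, K (p / ρ) := by
  have h := Real.smul_map_volume_mul_left hρ.ne'
  have : ∫⁻ t, K (t) = ENNReal.ofReal |ρ⁻¹| * ∫⁻ p, K (p / ρ) := by
    have h2 := Real.map_volume_mul_left (inv_ne_zero hρ.ne')
    have : ∫⁻ p, K (p / ρ) = ∫⁻ t, K t ∂(Measure.map (fun p => ρ⁻¹ * p) volume) := by
      rw [lintegral_map hK (by fun_prop)]
      simp [div_eq_inv_mul]
    rw [this]
    erw [h2]
    rw [lintegral_smul_measure, smul_eq_mul, ← mul_assoc, ← ENNReal.ofReal_mul (abs_nonneg _), inv_inv,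
      ← abs_mul, inv_mul_cancel₀ hρ.ne']
    simp
  rw [this, ← mul_assoc, ← ENNReal.ofReal_mul hρ.le, abs_of_pos (by positivity), mul_inv_cancel₀ hρ.ne']
  simp

lemma polar_int (k : ℝ × ℝ → ℝ) :
    ∫ q in {q : ℝ × ℝ | 0 < q.1 ∧ 0 ≤ q.2 ∧ q.2 < 2 * π}, q.1 * k (q.1 * cos q.2, q.1 * sin q.2)
      = ∫ y, k y := by
  rw [← integral_neg_eq_self k, ← integral_comp_polarCoord_symm, polarCoord_target]
  have hae : ({q : ℝ × ℝ | 0 < q.1 ∧ 0 ≤ q.2 ∧ q.2 < 2 * π} : Set (ℝ × ℝ)) =ᵐ[volume]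
      (Ioi 0 ×ˢ Ioo 0 (2 * π) : Set (ℝ × ℝ)) := by
    have : ({q : ℝ × ℝ | 0 < q.1 ∧ 0 ≤ q.2 ∧ q.2 < 2 * π} : Set (ℝ × ℝ)) =
      (Ioi 0 ×ˢ Ico 0 (2 * π) : Set (ℝ × ℝ)) := by
      ext q; simp
    rw [this]
    exact Measure.set_prod_ae_eq (ae_eq_refl _) Ioo_ae_eq_Ico.symm
  rw [setIntegral_congr_set hae, ← integral_indicator (by measurability),
    ← integral_indicator (by measurability), ← integral_add_right_eq_self _ ((0, π) : ℝ × ℝ)]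
  congr 1; ext q
  simp only [indicator_apply, mem_prod, mem_Ioi, mem_Ioo, Prod.fst_add, Prod.snd_add, add_zero,
    polarCoord_symm_apply, smul_eq_mul, cos_add_pi, sin_add_pi, Prod.neg_mk]
  refine if_congr ?_ (by simp) rfl
  constructor <;> rintro ⟨h1, h2, h3⟩ <;> exact ⟨h1, by linarith, by linarith⟩

/-- The support set of the density of `(e, p, ρ, z)`. -/
def Sset (a : ℝ) : Set ((ℝ × ℝ) × (ℝ × ℝ)) :=
  {z | 0 < z.2.1 ∧ (a - z.2.1) ^ 2 + z.2.2 ^ 2 < 1 ∧ Real.sqrt (1 + (z.1.2 / z.2.1) ^ 2) < z.1.1}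

lemma measSset (a : ℝ) : MeasurableSet (Sset a) := by
  have e : Sset a = {z | 0 < z.2.1} ∩ ({z | (a - z.2.1) ^ 2 + z.2.2 ^ 2 < 1} ∩
    {z | Real.sqrt (1 + (z.1.2 / z.2.1) ^ 2) < z.1.1}) := rfl
  rw [e]
  refine (measurableSet_lt ?_ ?_).inter ((measurableSet_lt ?_ ?_).inter
    (measurableSet_lt ?_ ?_)) <;> fun_prop

/-- The density of `(e, p, ρ, z)`. -/
def dens (a : ℝ) : (ℝ × ℝ) × (ℝ × ℝ) → ℝ≥0∞ :=
  (Sset a).indicator fun z => ENNReal.ofReal (2 * π) * (ENNReal.ofReal (2 * π) * ENNReal.ofReal z.1.1)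

lemma measdens (a : ℝ) : Measurable (dens a) :=
  Measurable.indicator (by fun_prop) (measSset a)

/-- The map `(x, v) ↦ ((e, p), (ρ, z))`. -/
def Tmap (q : R3 × R3) : (ℝ × ℝ) × (ℝ × ℝ) :=
  ((vb q.2, rad q.1 * dot q.2 (ephi q.1)), (rad q.1, q.1 2))

lemma measrad : Measurable rad := by unfold rad; fun_prop

lemma measvb : Measurable vb := by unfold vb nsq; fun_prop

lemma measdot : Measurable fun q : R3 × R3 => dot q.2 (ephi q.1) := by
  have := measrad
  simp only [dot, ephi, Fin.sum_univ_three]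
  simp
  fun_prop

lemma measTmap : Measurable Tmap := by
  have := measrad
  have := measvb
  have := measdot
  unfold Tmap
  fun_prop

lemma meastorus (a : ℝ) : MeasurableSet (torus a) :=
  measurableSet_lt (by fun_prop) (by fun_prop)

/-- Velocity integral. -/
def Kfun (f : (ℝ × ℝ) × (ℝ × ℝ) → ℝ≥0∞) (y : ℝ × ℝ) : ℝ≥0∞ :=
  ∫⁻ t : ℝ, ENNReal.ofReal (2 * π) *
      ∫⁻ e in Ioi (Real.sqrt (1 + t ^ 2)), ENNReal.ofReal e * f ((e, y.1 * t), y)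

lemma measK0 (f : (ℝ × ℝ) × (ℝ × ℝ) → ℝ≥0∞) (hf : Measurable f) :
    Measurable fun q : (ℝ × ℝ) × ℝ => ENNReal.ofReal (2 * π) *
      ∫⁻ e in Ioi (Real.sqrt (1 + q.2 ^ 2)), ENNReal.ofReal e * f ((e, q.1.1 * q.2), q.1) := by
  refine Measurable.const_mul ?_ _
  simp_rw [← lintegral_indicator measurableSet_Ioi]
  have : Measurable fun z : ((ℝ × ℝ) × ℝ) × ℝ =>
      indicator {z : ((ℝ × ℝ) × ℝ) × ℝ | Real.sqrt (1 + z.1.2 ^ 2) < z.2}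
       (fun z => ENNReal.ofReal z.2 * f ((z.2, z.1.1.1 * z.1.2), z.1.1)) z :=
    Measurable.indicator (by fun_prop) (measurableSet_lt (by fun_prop) (by fun_prop))
  exact this.lintegral_prod_right'

lemma measK (f : (ℝ × ℝ) × (ℝ × ℝ) → ℝ≥0∞) (hf : Measurable f) : Measurable (Kfun f) :=
  (measK0 f hf).lintegral_prod_right'

set_option maxHeartbeats 1000000 in
lemma core (a : ℝ) (ha : 1 < a) (f : (ℝ × ℝ) × (ℝ × ℝ) → ℝ≥0∞) (hf : Measurable f) :
    ∫⁻ q in torus a ×ˢ (univ : Set R3), f (Tmap q) = ∫⁻ z, dens a z * f z := by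
  have hT := measTmap
  have hd := measdens a
  have hK := measK f hf
  have hrad := measrad
  let D : Set (ℝ × ℝ) := {y | (a - y.1) ^ 2 + y.2 ^ 2 < 1}
  have hD : MeasurableSet D := measurableSet_lt (by fun_prop) (by fun_prop)
  have hkm : Measurable (D.indicator (Kfun f)) := hK.indicator hD
  calc ∫⁻ q in torus a ×ˢ (univ : Set R3), f (Tmap q)
      = ∫⁻ x in torus a, ∫⁻ v, f (Tmap (x, v)) := by
        rw [Measure.volume_eq_prod, ← Measure.prod_restrict, Measure.restrict_univ,
          lintegral_prod _ (by fun_prop)]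
    _ = ∫⁻ x in torus a, Kfun f (rad x, x 2) := by
        refine setLIntegral_congr_fun (meastorus a) fun x hx => ?_
        have hx' : (a - rad x) ^ 2 + (x 2) ^ 2 < 1 := hx
        have hr : 0 < rad x := by nlinarith [sq_nonneg (x 2)]
        exact lint_vel x hr (fun q => f ((q.1, rad x * q.2), (rad x, x 2))) (by fun_prop)
    _ = ∫⁻ x : R3, D.indicator (Kfun f) (rad x, x 2) := by
        rw [← lintegral_indicator (meastorus a)]
        rfl
    _ = ∫⁻ z : ℝ, ∫⁻ y : ℝ × ℝ, D.indicator (Kfun f) (Real.sqrt (y.1 ^ 2 + y.2 ^ 2), z) := by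
        rw [lint_R3 _ (by fun_prop)]
        rfl
    _ = ∫⁻ z : ℝ, ENNReal.ofReal (2 * π) *
          ∫⁻ r in Ioi (0:ℝ), ENNReal.ofReal r * D.indicator (Kfun f) (r, z) := by
        congr 1; ext z
        exact lint_radial (fun r => D.indicator (Kfun f) (r, z)) (by fun_prop)
    _ = ∫⁻ z : ℝ, ∫⁻ r : ℝ, ∫⁻ p : ℝ, ∫⁻ e : ℝ, dens a ((e, p), (r, z)) * f ((e, p), (r, z)) := by
        congr 1; ext z
        rw [← lintegral_const_mul _ (by fun_prop), ← lintegral_indicator measurableSet_Ioi]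
        congr 1; ext r
        by_cases hr : 0 < r
        · rw [indicator_of_mem (show r ∈ Ioi 0 from hr)]
          by_cases hy : (r, z) ∈ D
          · rw [indicator_of_mem hy]
            unfold Kfun
            have m1 : Measurable fun t : ℝ => ENNReal.ofReal (2 * π) *
                ∫⁻ e in Ioi (Real.sqrt (1 + t ^ 2)), ENNReal.ofReal e * f ((e, (r, z).1 * t), (r, z)) :=
              (measK0 f hf).comp (by fun_prop : Measurable fun t : ℝ => ((r, z), t))
            have m2 : Measurable fun p : ℝ => ENNReal.ofReal (2 * π) *
                ∫⁻ e in Ioi (Real.sqrt (1 + (p / r) ^ 2)),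
                  ENNReal.ofReal e * f ((e, (r, z).1 * (p / r)), (r, z)) :=
              m1.comp (by fun_prop : Measurable fun t : ℝ => t / r)
            rw [lint_scale r hr _ m1, ← lintegral_const_mul _ m2]
            congr 1; ext p
            dsimp only
            rw [← lintegral_const_mul _ (by fun_prop), ← lintegral_const_mul _ (by fun_prop),
              ← lintegral_indicator measurableSet_Ioi]
            congr 1; ext e
            rw [mul_div_cancel₀ _ hr.ne']
            by_cases he : Real.sqrt (1 + (p / r) ^ 2) < e
            · rw [indicator_of_mem (show e ∈ Ioi _ from he), dens, indicator_of_mem (show ((e, p), (r, z)) ∈ Sset a from ⟨hr, hy, he⟩)]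
              ring
            · rw [indicator_of_notMem (show e ∉ Ioi _ from he), dens, indicator_of_notMem (show ((e, p), (r, z)) ∉ Sset a from fun h => he h.2.2), zero_mul]
          · rw [indicator_of_notMem hy]
            have : ∀ p e, dens a ((e, p), (r, z)) = 0 := fun p e =>
              indicator_of_notMem (fun h => hy h.2.1) _
            simp [this]
        · rw [indicator_of_notMem (show r ∉ Ioi 0 from hr)]
          have : ∀ p e, dens a ((e, p), (r, z)) = 0 := fun p e =>
              indicator_of_notMem (fun h => hr h.1) _
          simp [this]
    _ = ∫⁻ z, dens a z * f z := by
        symm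
        rw [Measure.volume_eq_prod (ℝ × ℝ) (ℝ × ℝ), lintegral_prod_symm _ (by fun_prop)]
        have hm : Measurable fun y : ℝ × ℝ => ∫⁻ x : ℝ × ℝ, dens a (x, y) * f (x, y) :=
          Measurable.lintegral_prod_left' (f := fun z => dens a z * f z) (by fun_prop)
        rw [Measure.volume_eq_prod ℝ ℝ] at hm ⊢
        rw [lintegral_prod_symm _ hm.aemeasurable]
        congr 1; ext z
        congr 1; ext r
        rw [lintegral_prod_symm _ (by fun_prop)]

lemma map_eq (a : ℝ) (ha : 1 < a) :
    Measure.map Tmap (volume.restrict (torus a ×ˢ (univ : Set R3))) = volume.withDensity (dens a) := by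
  refine Measure.ext_of_lintegral _ fun f hf => ?_
  rw [lintegral_map hf measTmap, lintegral_withDensity_eq_lintegral_mul _ (measdens a) hf]
  exact core a ha f hf

lemma measIep (a : ℝ) : MeasurableSet {z : (ℝ × ℝ) × (ℝ × ℝ) | z.2 ∈ Iep a z.1.1 z.1.2} := by
  have e : {z : (ℝ × ℝ) × (ℝ × ℝ) | z.2 ∈ Iep a z.1.1 z.1.2} =
    {z | 0 < z.2.1} ∩ ({z | z.2.1 < 1} ∩ ({z | 0 ≤ z.2.2} ∩ ({z | z.2.2 < 2 * π} ∩
    {z | |z.1.2| / Real.sqrt (z.1.1 ^ 2 - 1) < a + z.2.1 * Real.cos z.2.2}))) := rfl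
  rw [e]
  have habs : Measurable fun x : ℝ => |x| := continuous_abs.measurable
  refine (measurableSet_lt ?_ ?_).inter ((measurableSet_lt ?_ ?_).inter ((measurableSet_le ?_ ?_).inter
    ((measurableSet_lt ?_ ?_).inter (measurableSet_lt ?_ ?_)))) <;> fun_prop

lemma measIep1 (a e p : ℝ) : MeasurableSet (Iep a e p) :=
  (measIep a).preimage (measurable_prodMk_left (x := (e, p)))

lemma meas_int (a : ℝ) (k : ℝ × ℝ → ℝ) (hk : Measurable k) :
    Measurable fun ep : ℝ × ℝ => ∫ q in Iep a ep.1 ep.2, k q := by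
  have h1 : Measurable fun z : (ℝ × ℝ) × (ℝ × ℝ) =>
      indicator {z : (ℝ × ℝ) × (ℝ × ℝ) | z.2 ∈ Iep a z.1.1 z.1.2} (fun z => k z.2) z :=
    Measurable.indicator (by fun_prop) (measIep a)
  have h2 := h1.stronglyMeasurable.integral_prod_right' (ν := volume)
  convert h2.measurable using 2 with ep
  rw [← integral_indicator (measIep1 a _ _)]
  rfl

lemma meas_tp (a : ℝ) : Measurable fun q : ℝ × ℝ => torusPt a q.1 q.2 := by
  unfold torusPt
  rw [measurable_pi_iff]
  intro i
  fin_cases i <;> simp <;> fun_prop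

lemma meas_projg (a : ℝ) (h : R3 → ℝ) (hhm : Measurable h) :
    Measurable fun ep : ℝ × ℝ => projg a h ep.1 ep.2 := by
  have := meas_tp a
  unfold projg
  refine Measurable.ite ?_ ?_ measurable_const
  · have habs : Measurable fun x : ℝ => |x| := continuous_abs.measurable
    have e : {ep : ℝ × ℝ | 1 < ep.1 ∧ |ep.2| < (a + 1) * Real.sqrt (ep.1 ^ 2 - 1)} =
      {ep | 1 < ep.1} ∩ {ep | |ep.2| < (a + 1) * Real.sqrt (ep.1 ^ 2 - 1)} := rfl
    rw [e]
    refine (measurableSet_lt ?_ ?_).inter (measurableSet_lt ?_ ?_) <;> fun_prop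
  · exact (meas_int a (fun q => h (torusPt a q.1 q.2) * q.1) (by fun_prop)).div (meas_int a (fun q => q.1) (by fun_prop))

/-- The slice of `Sset`. -/
def Jset (a e p : ℝ) : Set (ℝ × ℝ) := {y | ((e, p), y) ∈ Sset a}

lemma measJ (a e p : ℝ) : MeasurableSet (Jset a e p) :=
  (measSset a).preimage (measurable_prodMk_left (x := (e, p)))

lemma memJ (a e p : ℝ) (ha : 1 < a) (he : 1 < e) (y : ℝ × ℝ) :
    y ∈ Jset a e p ↔ (a - y.1) ^ 2 + y.2 ^ 2 < 1 ∧ |p| / Real.sqrt (e ^ 2 - 1) < y.1 := by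
  have hs : 0 < Real.sqrt (e ^ 2 - 1) := Real.sqrt_pos.2 (by nlinarith)
  have key : 0 < y.1 → (Real.sqrt (1 + (p / y.1) ^ 2) < e ↔ |p| / Real.sqrt (e ^ 2 - 1) < y.1) := by
    intro hy
    rw [Real.sqrt_lt (by positivity) (by linarith), div_lt_comm₀ hs hy,
      Real.lt_sqrt (by positivity), div_pow, div_pow, sq_abs]
    constructor <;> intro <;> linarith
  constructor
  · rintro ⟨h1, h2, h3⟩
    exact ⟨h2, (key h1).1 h3⟩
  · rintro ⟨h1, h2⟩
    have : 0 < y.1 := lt_of_le_of_lt (by positivity) h2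
    exact ⟨this, h1, (key this).2 h2⟩

lemma J_polar (a e p : ℝ) (ha : 1 < a) (he : 1 < e) (k : ℝ × ℝ → ℝ) :
    ∫ y in Jset a e p, k y = ∫ q in Iep a e p, k (a + q.1 * cos q.2, q.1 * sin q.2) * q.1 := by
  rw [← integral_indicator (measJ a e p), ← integral_add_left_eq_self _ ((a, 0) : ℝ × ℝ), ← polar_int,
    ← integral_indicator (measIep1 a e p), ← integral_indicator]
  · congr 1; ext q
    by_cases hq : 0 < q.1 ∧ 0 ≤ q.2 ∧ q.2 < 2 * π
    · rw [indicator_of_mem (show q ∈ {q : ℝ × ℝ | 0 < q.1 ∧ 0 ≤ q.2 ∧ q.2 < 2 * π} from hq)]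
      simp only [Prod.mk_add_mk, zero_add]
      have : ((a - (a + q.1 * cos q.2)) ^ 2 + (q.1 * sin q.2) ^ 2 < 1 ∧
          |p| / Real.sqrt (e ^ 2 - 1) < a + q.1 * cos q.2) ↔ q ∈ Iep a e p := by
        have e1 : (a - (a + q.1 * cos q.2)) ^ 2 + (q.1 * sin q.2) ^ 2 = q.1 ^ 2 := by
          linear_combination q.1 ^ 2 * Real.sin_sq_add_cos_sq q.2
        rw [e1, sq_lt_one_iff₀ hq.1.le]
        exact ⟨fun h => ⟨hq.1, h.1, hq.2.1, hq.2.2, h.2⟩, fun h => ⟨h.2.1, h.2.2.2.2⟩⟩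
      have h2 : (a + q.1 * cos q.2, q.1 * sin q.2) ∈ Jset a e p ↔ q ∈ Iep a e p := by
        rw [memJ a e p ha he]; exact this
      by_cases hI : q ∈ Iep a e p
      · rw [indicator_of_mem hI, indicator_of_mem (h2.2 hI), mul_comm]
      · rw [indicator_of_notMem hI, indicator_of_notMem (fun h => hI (h2.1 h)), mul_zero]
    · rw [indicator_of_notMem (show q ∉ {q : ℝ × ℝ | 0 < q.1 ∧ 0 ≤ q.2 ∧ q.2 < 2 * π} from hq), indicator_of_notMem]
      exact fun h => hq ⟨h.1, h.2.2.1, h.2.2.2.1⟩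
  · have e : {q : ℝ × ℝ | 0 < q.1 ∧ 0 ≤ q.2 ∧ q.2 < 2 * π} =
      {q | 0 < q.1} ∩ ({q | 0 ≤ q.2} ∩ {q | q.2 < 2 * π}) := rfl
    rw [e]
    refine (measurableSet_lt ?_ ?_).inter ((measurableSet_le ?_ ?_).inter
      (measurableSet_lt ?_ ?_)) <;> fun_prop

lemma J_subset (a e p : ℝ) : Jset a e p ⊆ Icc (a - 1) (a + 1) ×ˢ Icc (-1) 1 := by
  rintro y ⟨-, h, -⟩
  simp only at h
  have h1 : |a - y.1| ≤ 1 := abs_le_one_iff_mul_self_le_one.2 (by nlinarith [sq_nonneg y.2])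
  have h2 : |y.2| ≤ 1 := abs_le_one_iff_mul_self_le_one.2 (by nlinarith [sq_nonneg (a - y.1)])
  rw [abs_le] at h1 h2
  exact ⟨⟨by linarith, by linarith⟩, h2⟩

lemma J_zero (a e p : ℝ) (ha : 1 < a) (h : R3 → ℝ) (hhm : Measurable h) (Ch : ℝ)
    (hhb : ∀ x, |h x| ≤ Ch) :
    ∫ y in Jset a e p, (h ![y.1, 0, y.2] - projg a h e p) = 0 := by
  by_cases hne : (Jset a e p).Nonempty
  · obtain ⟨y, hy⟩ := hne
    have he : 1 < e := lt_of_le_of_lt (Real.one_le_sqrt.2 (by nlinarith [sq_nonneg (p / y.1)])) hy.2.2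
    have hs : 0 < Real.sqrt (e ^ 2 - 1) := Real.sqrt_pos.2 (by nlinarith)
    have hp : |p| < (a + 1) * Real.sqrt (e ^ 2 - 1) := by
      have h1 := ((memJ a e p ha he y).1 hy).2
      have h2 := (J_subset a e p hy).1.2
      rw [← div_lt_iff₀ hs]
      linarith
    have hfin : volume (Jset a e p) < ∞ :=
      lt_of_le_of_lt (measure_mono (J_subset a e p)) (isCompact_Icc.prod isCompact_Icc).measure_lt_top
    have : IsFiniteMeasure (volume.restrict (Jset a e p)) := ⟨by simpa using hfin⟩
    have hm : Measurable fun y : ℝ × ℝ => h ![y.1, 0, y.2] := by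
      refine hhm.comp ?_
      rw [measurable_pi_iff]
      intro i
      fin_cases i <;> simp <;> fun_prop
    have hi : Integrable (fun y : ℝ × ℝ => h ![y.1, 0, y.2]) (volume.restrict (Jset a e p)) :=
      Integrable.of_bound hm.aestronglyMeasurable Ch (Eventually.of_forall fun y => hhb _)
    rw [integral_sub hi (integrable_const _)]
    have e1 := J_polar a e p ha he (fun y => h ![y.1, 0, y.2])
    have e2 := J_polar a e p ha he (fun y => 1)
    simp only [one_mul] at e2
    have e3 : ∫ y in Jset a e p, projg a h e p = projg a h e p * ∫ y in Jset a e p, (1 : ℝ) := by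
      rw [← integral_const_mul]; simp
    rw [e3]
    have e4 : projg a h e p = (∫ y in Jset a e p, h ![y.1, 0, y.2]) / ∫ y in Jset a e p, (1 : ℝ) := by
      rw [projg, if_pos ⟨he, hp⟩, e1, e2]
      rfl
    rw [e4]
    by_cases hv : volume (Jset a e p) = 0
    · rw [Measure.restrict_eq_zero.2 hv]; simp
    · have : ∫ y in Jset a e p, (1 : ℝ) ≠ 0 := by
        simp [Measure.real, ENNReal.toReal_eq_zero_iff, hv, hfin.ne]
      rw [div_mul_cancel₀ _ this, sub_self]
  · rw [not_nonempty_iff_eq_empty.1 hne]; simp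

lemma h_sym (h : R3 → ℝ) (hhs : torSym h) (x : R3) : h ![rad x, 0, x 2] = h x := by
  by_cases hr : rad x = 0
  · have : (x 0) ^ 2 + (x 1) ^ 2 = 0 := by
      have := (Real.sqrt_eq_zero (by positivity)).1 hr
      exact this
    have h0 : x 0 = 0 := by nlinarith [sq_nonneg (x 0), sq_nonneg (x 1)]
    have h1 : x 1 = 0 := by nlinarith [sq_nonneg (x 0), sq_nonneg (x 1)]
    congr 1
    ext i
    fin_cases i <;> simp [hr, h0, h1]
  · let z : ℂ := ⟨x 0, x 1⟩
    have hz : ‖z‖ = rad x := by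
      rw [Complex.norm_def, Complex.normSq_mk, rad]; congr 1; ring
    rw [← hhs z.arg ![rad x, 0, x 2]]
    congr 1
    ext i
    have hc := Complex.norm_mul_cos_arg z
    have hs := Complex.norm_mul_sin_arg z
    rw [hz] at hc hs
    fin_cases i
    · simp [rotZ]; rw [mul_comm, hc]
    · simp [rotZ]; rw [mul_comm, hs]
    · simp [rotZ]

/-- Lemma 5.6. In the homogeneous case `e = ⟨v⟩`, `p = ρ(x)v_φ`,
for every weight `w(e,p)` with the stated decay, every bounded measurable toroidally
symmetric `h` and every bounded measurable `ξ(e,p)`, the explicit average `g(e,p)`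
satisfies `∫ ξ(e,p)(h − g(e,p)) dν = 0`, i.e. `g(e,p)` is the `L²(ν)`-orthogonal
projection of `h` onto the functions of `(e,p)`. -/
theorem stmt9 (a : ℝ) (ha : 1 < a)
    (w : ℝ → ℝ → ℝ) (hwm : Measurable fun q : ℝ × ℝ => w q.1 q.2)
    (hw0 : ∀ e p : ℝ, 0 ≤ w e p)
    (C γ : ℝ) (hγ : 3 < γ) (hwb : ∀ e p : ℝ, 1 < e → w e p ≤ C / (1 + e ^ γ))
    (h : R3 → ℝ) (hhm : Measurable h) (Ch : ℝ) (hhb : ∀ x, |h x| ≤ Ch) (hhs : torSym h) :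
    ∀ ξ : ℝ × ℝ → ℝ, Measurable ξ → (∃ Cξ : ℝ, ∀ q, |ξ q| ≤ Cξ) →
      ∫ q : R3 × R3 in (torus a) ×ˢ (univ : Set R3),
          ξ (vb q.2, rad q.1 * dot q.2 (ephi q.1))
            * (h q.1 - projg a h (vb q.2) (rad q.1 * dot q.2 (ephi q.1)))
            * w (vb q.2) (rad q.1 * dot q.2 (ephi q.1)) = 0 := by
  intro ξ hξ _
  let f : (ℝ × ℝ) × (ℝ × ℝ) → ℝ := fun z =>
    ξ z.1 * (h ![z.2.1, 0, z.2.2] - projg a h z.1.1 z.1.2) * w z.1.1 z.1.2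
  have hm : Measurable fun z : (ℝ × ℝ) × (ℝ × ℝ) => h ![z.2.1, 0, z.2.2] := by
    refine hhm.comp ?_
    rw [measurable_pi_iff]
    intro i
    fin_cases i <;> simp <;> fun_prop
  have hf : Measurable f :=
    ((hξ.comp measurable_fst).mul (hm.sub ((meas_projg a h hhm).comp measurable_fst))).mul
      (hwm.comp measurable_fst)
  have h1 : ∀ q : R3 × R3, ξ (vb q.2, rad q.1 * dot q.2 (ephi q.1))
            * (h q.1 - projg a h (vb q.2) (rad q.1 * dot q.2 (ephi q.1)))
            * w (vb q.2) (rad q.1 * dot q.2 (ephi q.1)) = f (Tmap q) := by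
    intro q
    simp only [f, Tmap, h_sym h hhs]
  simp only [h1]
  rw [← integral_map measTmap.aemeasurable hf.aestronglyMeasurable, map_eq a ha,
    integral_withDensity_eq_integral_toReal_smul (measdens a)]
  · by_cases hi : Integrable fun z => (dens a z).toReal • f z
    · rw [Measure.volume_eq_prod] at hi ⊢
      rw [integral_prod _ hi]
      refine integral_eq_zero_of_ae (Eventually.of_forall fun ep => ?_)
      obtain ⟨e, p⟩ := ep
      have h2 : ∀ y, (dens a ((e, p), y)).toReal • f ((e, p), y) =
          (ξ (e, p) * w e p * (ENNReal.ofReal (2 * π) * (ENNReal.ofReal (2 * π) * ENNReal.ofReal e)).toReal) *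
          (Jset a e p).indicator (fun y => h ![y.1, 0, y.2] - projg a h e p) y := by
        intro y
        by_cases hy : y ∈ Jset a e p
        · rw [indicator_of_mem hy, dens, indicator_of_mem (show _ ∈ Sset a from hy)]
          simp only [f, smul_eq_mul]
          ring
        · rw [indicator_of_notMem hy, dens, indicator_of_notMem (show _ ∉ Sset a from hy)]
          simp
      simp only [h2]
      rw [integral_const_mul, integral_indicator (measJ a e p), J_zero a e p ha h hhm Ch hhb]
      simp
    · exact integral_undef hi
  · refine Eventually.of_forall fun z => ?_
    by_cases hz : z ∈ Sset a
    · rw [dens, indicator_of_mem hz]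
      exact ENNReal.mul_lt_top ENNReal.ofReal_lt_top
        (ENNReal.mul_lt_top ENNReal.ofReal_lt_top ENNReal.ofReal_lt_top)
    · rw [dens, indicator_of_notMem hz]; simp

end
end
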